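/- arXiv:1105.4533 — 4 statements merged into one kernel-verified Lean document; each statement's English description precedes it below -/
import Mathlib

section
/- There exists a numerical constant C ≥ 1 such that for every N ≥ 1 and every function f : {-1,+1}^N → ℝ, Var_μ(f) ≤ C · Σ_{i=1}^N ‖D_i f‖₂² / (1 + log(‖D_i f‖₂ / ‖D_i f‖₁)), where for indices i with ‖D_i f‖₁ = 0 the corresponding summand is interpreted as 0. -/
/-- Expectation with respect to the uniform probability measure on the discrete
cube `{-1,+1}^N`, modeled as `Fin N → Bool`. -/
noncomputable def cubeE (N : ℕ) (g : (Fin N → Bool) → ℝ) : ℝ :=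
  (∑ x : Fin N → Bool, g x) / 2 ^ N

/-- `L^p(μ)` norm, `μ` the uniform measure on the cube. -/
noncomputable def cubeNorm (N : ℕ) (p : ℝ) (g : (Fin N → Bool) → ℝ) : ℝ :=
  (cubeE N fun x => |g x| ^ p) ^ (1 / p)

/-- Variance with respect to the uniform measure on the cube. -/
noncomputable def cubeVar (N : ℕ) (f : (Fin N → Bool) → ℝ) : ℝ :=
  cubeE N (fun x => f x ^ 2) - (cubeE N f) ^ 2

/-- `D_i f (x) = f(τ_i x) - f(x)`, where `τ_i` flips the `i`-th coordinate. -/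
def cubeD (N : ℕ) (i : Fin N) (f : (Fin N → Bool) → ℝ) (x : Fin N → Bool) : ℝ :=
  f (Function.update x i (!x i)) - f x

open Finset

section Expectation

variable {N : ℕ}

theorem cubeE_nonneg {g : (Fin N → Bool) → ℝ} (hg : ∀ x, 0 ≤ g x) : 0 ≤ cubeE N g :=
  div_nonneg (sum_nonneg fun x _ => hg x) (by positivity)

theorem cubeE_add (f g : (Fin N → Bool) → ℝ) :
    cubeE N (fun x => f x + g x) = cubeE N f + cubeE N g := by
  simp only [cubeE, sum_add_distrib, add_div]

theorem cubeE_const_mul (a : ℝ) (g : (Fin N → Bool) → ℝ) :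
    cubeE N (fun x => a * g x) = a * cubeE N g := by
  simp only [cubeE, ← mul_sum, mul_div_assoc]

theorem cubeE_sum {ι : Type*} (s : Finset ι) (g : ι → (Fin N → Bool) → ℝ) :
    cubeE N (fun x => ∑ i ∈ s, g i x) = ∑ i ∈ s, cubeE N (g i) := by
  simp only [cubeE]
  rw [sum_comm, sum_div]

/-- Cauchy–Schwarz inequality on the cube. -/
theorem cubeE_mul_sq_le (f g : (Fin N → Bool) → ℝ) :
    cubeE N (fun x => f x * g x) ^ 2 ≤
      cubeE N (fun x => f x ^ 2) * cubeE N (fun x => g x ^ 2) := by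
  simp only [cubeE]
  rw [div_pow, div_mul_div_comm, ← sq]
  gcongr
  exact sum_mul_sq_le_sq_mul_sq _ _ _

/-- The coordinate flip, as a map of the cube. -/
def cubeFlip (i : Fin N) (x : Fin N → Bool) : Fin N → Bool :=
  Function.update x i (!x i)

theorem cubeFlip_involutive (i : Fin N) : Function.Involutive (cubeFlip i) := fun x => by
  simp [cubeFlip]

theorem cubeE_comp_flip (i : Fin N) (g : (Fin N → Bool) → ℝ) :
    cubeE N (fun x => g (cubeFlip i x)) = cubeE N g := by
  simp only [cubeE]
  congr 1
  exact Equiv.sum_comp (cubeFlip_involutive i).toPerm g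

theorem cubeE_eq_zero_of_flip_neg (i : Fin N) {g : (Fin N → Bool) → ℝ}
    (hg : ∀ x, g (cubeFlip i x) = -g x) : cubeE N g = 0 := by
  have h := cubeE_comp_flip i g
  have h' : cubeE N (fun x => g (cubeFlip i x)) = -cubeE N g := by
    simp only [hg, cubeE, sum_neg_distrib, neg_div]
  linarith

end Expectation

section Walsh

variable {N : ℕ}

/-- The sign `±1` attached to a Boolean. -/
def boolSign (b : Bool) : ℝ := if b then 1 else -1

theorem boolSign_not (b : Bool) : boolSign (!b) = -boolSign b := by
  cases b <;> simp [boolSign]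

theorem boolSign_sq (b : Bool) : boolSign b ^ 2 = 1 := by
  cases b <;> simp [boolSign]

/-- The Walsh function indexed by `S`. -/
def walsh (S : Finset (Fin N)) (x : Fin N → Bool) : ℝ := ∏ i ∈ S, boolSign (x i)

/-- The Walsh coefficient of `f` at `S`. -/
noncomputable def walshCoeff (f : (Fin N → Bool) → ℝ) (S : Finset (Fin N)) : ℝ :=
  cubeE N fun x => f x * walsh S x

theorem walsh_flip_of_notMem {i : Fin N} {S : Finset (Fin N)} (hi : i ∉ S)
    (x : Fin N → Bool) : walsh S (cubeFlip i x) = walsh S x := by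
  refine prod_congr rfl fun j hj => ?_
  have : j ≠ i := fun h => hi (h ▸ hj)
  simp [cubeFlip, this]

theorem walsh_insert {i : Fin N} {S : Finset (Fin N)} (hi : i ∉ S) (x : Fin N → Bool) :
    walsh (insert i S) x = boolSign (x i) * walsh S x := prod_insert hi

theorem boolSign_flip (i : Fin N) (x : Fin N → Bool) :
    boolSign (cubeFlip i x i) = -boolSign (x i) := by
  simp [cubeFlip, boolSign_not]

theorem walsh_flip_of_mem {i : Fin N} {S : Finset (Fin N)} (hi : i ∈ S)
    (x : Fin N → Bool) : walsh S (cubeFlip i x) = -walsh S x := by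
  rw [← insert_erase hi, walsh_insert (notMem_erase i S), walsh_insert (notMem_erase i S),
    walsh_flip_of_notMem (notMem_erase i S), boolSign_flip, neg_mul]

theorem sum_walsh_mul_walsh (x y : Fin N → Bool) :
    ∑ S : Finset (Fin N), walsh S x * walsh S y = if x = y then 2 ^ N else 0 := by
  have h : ∑ S : Finset (Fin N), walsh S x * walsh S y =
      ∏ i : Fin N, (1 + boolSign (x i) * boolSign (y i)) := by
    rw [prod_one_add, powerset_univ]
    simp only [walsh, prod_mul_distrib]
  rw [h]
  split_ifs with hxy
  · subst hxy
    simp only [← sq, boolSign_sq]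
    norm_num
  · obtain ⟨i, hi⟩ := Function.ne_iff.mp hxy
    refine prod_eq_zero (mem_univ i) ?_
    cases hx : x i <;> cases hy : y i <;> simp_all [boolSign]

theorem sum_walshCoeff_mul_walsh (f : (Fin N → Bool) → ℝ) (x : Fin N → Bool) :
    ∑ S, walshCoeff f S * walsh S x = f x := by
  have h : ∀ S, walshCoeff f S * walsh S x =
      (∑ y, f y * (walsh S y * walsh S x)) / 2 ^ N := fun S => by
    simp only [walshCoeff, cubeE, div_mul_eq_mul_div, sum_mul, mul_assoc]
  simp only [h]
  rw [← sum_div, sum_comm]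
  simp only [← mul_sum, sum_walsh_mul_walsh]
  simp

theorem cubeE_mul_sum_walsh (f : (Fin N → Bool) → ℝ) (𝒮 : Finset (Finset (Fin N))) :
    cubeE N (fun x => f x * ∑ S ∈ 𝒮, walshCoeff f S * walsh S x) =
      ∑ S ∈ 𝒮, walshCoeff f S ^ 2 := by
  simp only [mul_sum]
  rw [cubeE_sum]
  refine sum_congr rfl fun S _ => ?_
  simp only [mul_left_comm (f _)]
  rw [cubeE_const_mul, sq]
  rfl

/-- Parseval's identity on the cube. -/
theorem sum_walshCoeff_sq (f : (Fin N → Bool) → ℝ) :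
    ∑ S, walshCoeff f S ^ 2 = cubeE N (fun x => f x ^ 2) := by
  rw [← cubeE_mul_sum_walsh]
  simp only [sum_walshCoeff_mul_walsh, sq]

theorem walshCoeff_cubeD (f : (Fin N → Bool) → ℝ) (i : Fin N) (S : Finset (Fin N)) :
    walshCoeff (cubeD N i f) S = if i ∈ S then -2 * walshCoeff f S else 0 := by
  have h : walshCoeff (cubeD N i f) S =
      cubeE N (fun x => f x * walsh S (cubeFlip i x)) - walshCoeff f S := by
    rw [← cubeE_comp_flip i (fun x => f x * walsh S (cubeFlip i x)), eq_sub_iff_add_eq,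
      walshCoeff, walshCoeff, ← cubeE_add]
    congr 1
    ext x
    rw [cubeFlip_involutive i x, cubeD, cubeFlip]
    ring
  rw [h]
  split_ifs with hi
  · simp only [walsh_flip_of_mem hi, mul_neg]
    have := cubeE_const_mul (N := N) (-1) (fun x => f x * walsh S x)
    simp only [neg_mul, one_mul] at this
    rw [this, walshCoeff]
    ring
  · simp only [walsh_flip_of_notMem hi, walshCoeff, sub_self]

/-- Bonami's inequality: the `L⁴` norm of a Walsh polynomial is at most the `L²` norm of the
polynomial whose coefficients are multiplied by `√3 ^ |S|`. -/
theorem cubeE_walsh_sum_pow_four_le (U : Finset (Fin N)) (c : Finset (Fin N) → ℝ) :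
    cubeE N (fun x => (∑ S ∈ U.powerset, c S * walsh S x) ^ 4) ≤
      (∑ S ∈ U.powerset, 3 ^ #S * c S ^ 2) ^ 2 := by
  induction U using Finset.induction_on generalizing c with
  | empty =>
    refine le_of_eq ?_
    simp [walsh, cubeE]
    ring
  | insert i U hi ih =>
    have hmem : ∀ S ∈ U.powerset, i ∉ S := fun S hS h => hi (mem_powerset.mp hS h)
    set A : (Fin N → Bool) → ℝ := fun x => ∑ S ∈ U.powerset, c S * walsh S x with hA
    set B : (Fin N → Bool) → ℝ := fun x => ∑ S ∈ U.powerset, c (insert i S) * walsh S x with hB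
    have hAflip : ∀ x, A (cubeFlip i x) = A x := fun x =>
      sum_congr rfl fun S hS => by rw [walsh_flip_of_notMem (hmem S hS)]
    have hBflip : ∀ x, B (cubeFlip i x) = B x := fun x =>
      sum_congr rfl fun S hS => by rw [walsh_flip_of_notMem (hmem S hS)]
    have hsplit : ∀ x, ∑ S ∈ (insert i U).powerset, c S * walsh S x =
        A x + boolSign (x i) * B x := fun x => by
      rw [sum_powerset_insert hi, hA, hB, mul_sum]
      congr 1
      refine sum_congr rfl fun S hS => ?_
      rw [walsh_insert (hmem S hS)]
      ring
    have hcoef : ∑ S ∈ (insert i U).powerset, (3 : ℝ) ^ #S * c S ^ 2 =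
        ∑ S ∈ U.powerset, 3 ^ #S * c S ^ 2 +
          3 * ∑ S ∈ U.powerset, 3 ^ #S * c (insert i S) ^ 2 := by
      rw [sum_powerset_insert hi, mul_sum]
      congr 1
      refine sum_congr rfl fun S hS => ?_
      rw [card_insert_of_notMem (hmem S hS)]
      ring
    have hodd : cubeE N (fun x => boolSign (x i) * (4 * A x ^ 3 * B x + 4 * A x * B x ^ 3)) = 0 :=
      cubeE_eq_zero_of_flip_neg i fun x => by
        rw [hAflip, hBflip, boolSign_flip, neg_mul]
    have hexp : cubeE N (fun x => (A x + boolSign (x i) * B x) ^ 4) =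
        cubeE N (fun x => A x ^ 4) + 6 * cubeE N (fun x => A x ^ 2 * B x ^ 2) +
          cubeE N (fun x => B x ^ 4) := by
      rw [← add_zero (_ + _ + _), ← hodd, ← cubeE_const_mul, ← cubeE_add, ← cubeE_add,
        ← cubeE_add]
      congr 1
      ext x
      have h := boolSign_sq (x i)
      generalize boolSign (x i) = s at h ⊢
      linear_combination (6 * A x ^ 2 * B x ^ 2 + (s ^ 2 + 1) * B x ^ 4 + 4 * s * A x * B x ^ 3) * h
    have ihA := ih c
    have ihB := ih fun S => c (insert i S)
    set a := ∑ S ∈ U.powerset, (3 : ℝ) ^ #S * c S ^ 2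
    set b := ∑ S ∈ U.powerset, (3 : ℝ) ^ #S * c (insert i S) ^ 2
    have ha0 : 0 ≤ a := sum_nonneg fun S _ => by positivity
    have hb0 : 0 ≤ b := sum_nonneg fun S _ => by positivity
    have hcs : cubeE N (fun x => A x ^ 2 * B x ^ 2) ≤ a * b := by
      refine le_of_sq_le_sq ?_ (by positivity)
      refine (cubeE_mul_sq_le (fun x => A x ^ 2) (fun x => B x ^ 2)).trans ?_
      simp only [← pow_mul, Nat.reduceMul]
      rw [mul_pow]
      exact mul_le_mul ihA ihB (cubeE_nonneg fun x => by positivity) (by positivity)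
    simp only [hsplit]
    rw [hcoef, hexp]
    change cubeE N (fun x => A x ^ 4) ≤ a ^ 2 at ihA
    change cubeE N (fun x => B x ^ 4) ≤ b ^ 2 at ihB
    nlinarith [mul_nonneg ha0 hb0, sq_nonneg b]

/-- Level inequality: the Walsh energy of `g` at levels at most `m` is controlled by
`‖g‖₁ ‖g‖₂`. -/
theorem sum_walshCoeff_sq_le_of_card_le (g : (Fin N → Bool) → ℝ) (m : ℕ) :
    ∑ S with #S ≤ m, walshCoeff g S ^ 2 ≤
      3 ^ m * (cubeE N (fun x => |g x|) * √(cubeE N fun x => g x ^ 2)) := by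
  set W := ∑ S with #S ≤ m, walshCoeff g S ^ 2 with hW
  have hW0 : 0 ≤ W := sum_nonneg fun S _ => by positivity
  set h : (Fin N → Bool) → ℝ := fun x => ∑ S with #S ≤ m, walshCoeff g S * walsh S x
  have hWE : cubeE N (fun x => g x * h x) = W := cubeE_mul_sum_walsh g _
  have hfour : cubeE N (fun x => h x ^ 4) ≤ (3 ^ m * W) ^ 2 := by
    have hb := cubeE_walsh_sum_pow_four_le univ fun S : Finset (Fin N) =>
      if #S ≤ m then walshCoeff g S else 0
    simp only [powerset_univ, ite_mul, zero_mul, ← sum_filter] at hb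
    refine hb.trans (pow_le_pow_left₀ (sum_nonneg fun S _ => by positivity) ?_ 2)
    rw [hW, mul_sum, sum_filter]
    refine sum_le_sum fun S _ => ?_
    split_ifs with hS
    · gcongr
      norm_num
    · simp
  have hg0 : 0 ≤ cubeE N (fun x => |g x|) := cubeE_nonneg fun x => abs_nonneg _
  have hg2 : 0 ≤ cubeE N (fun x => g x ^ 2) := cubeE_nonneg fun x => sq_nonneg _
  have hcs1 : W ^ 2 ≤ cubeE N (fun x => |g x|) * cubeE N (fun x => |g x| * h x ^ 2) := by
    have := cubeE_mul_sq_le (fun x => √|g x| * SignType.sign (g x)) (fun x => √|g x| * h x)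
    have h1 : ∀ x, √|g x| * SignType.sign (g x) * (√|g x| * h x) = g x * h x := fun x => by
      rw [mul_mul_mul_comm, mul_comm (√_ * _)]
      rw [Real.mul_self_sqrt (abs_nonneg _), mul_right_comm, sign_mul_abs]
    simp only [h1, hWE, mul_pow, Real.sq_sqrt (abs_nonneg _)] at this
    refine this.trans (mul_le_mul_of_nonneg_right ?_ (cubeE_nonneg fun x => by positivity))
    simp only [cubeE]
    gcongr with x
    rcases lt_trichotomy (g x) 0 with hx | hx | hx <;> simp [hx]
  have hcs2 : cubeE N (fun x => |g x| * h x ^ 2) ≤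
      √(cubeE N fun x => g x ^ 2) * (3 ^ m * W) := by
    refine le_of_sq_le_sq ?_ (by positivity)
    refine (cubeE_mul_sq_le (fun x => |g x|) (fun x => h x ^ 2)).trans ?_
    simp only [sq_abs, ← pow_mul, Nat.reduceMul]
    rw [mul_pow, Real.sq_sqrt hg2]
    exact mul_le_mul_of_nonneg_left hfour hg2
  rcases hW0.eq_or_lt with h0 | hpos
  · rw [← h0]
    positivity
  · refine le_of_mul_le_mul_right ?_ hpos
    calc W * W = W ^ 2 := (sq W).symm
      _ ≤ _ := hcs1
      _ ≤ _ := mul_le_mul_of_nonneg_left hcs2 hg0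
      _ = _ := by ring

theorem sum_walshCoeff_sq_div_card_le (g : (Fin N → Bool) → ℝ) (m : ℕ) :
    ∑ S, walshCoeff g S ^ 2 / #S ≤
      3 ^ m * (cubeE N (fun x => |g x|) * √(cubeE N fun x => g x ^ 2)) +
        cubeE N (fun x => g x ^ 2) / (m + 1) := by
  refine le_trans ?_ (add_le_add_left (sum_walshCoeff_sq_le_of_card_le g m) _)
  rw [← sum_walshCoeff_sq, sum_filter, sum_div, ← sum_add_distrib]
  refine sum_le_sum fun S _ => ?_
  split_ifs with hS
  · refine le_add_of_le_of_nonneg ?_ (by positivity)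
    rcases Nat.eq_zero_or_pos #S with h0 | h0
    · simp only [h0, Nat.cast_zero, div_zero]
      positivity
    · exact div_le_self (sq_nonneg _) (by exact_mod_cast h0)
  · rw [zero_add]
    gcongr
    exact_mod_cast not_le.mp hS

theorem cubeVar_eq_sum_walshCoeff_cubeD (f : (Fin N → Bool) → ℝ) :
    cubeVar N f = 1 / 4 * ∑ i, ∑ S, walshCoeff (cubeD N i f) S ^ 2 / #S := by
  have hzero : walshCoeff f ∅ = cubeE N f := by simp [walshCoeff, walsh]
  rw [cubeVar, ← sum_walshCoeff_sq, ← hzero, ← sum_erase_eq_sub (mem_univ _), sum_comm, mul_sum]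
  refine Eq.trans (sum_congr rfl fun S hS => ?_) (sum_erase univ (a := ∅) (by simp))
  have hcard : (#S : ℝ) ≠ 0 := by
    simpa using ne_of_mem_erase hS
  simp only [walshCoeff_cubeD, ← sum_div, ite_pow, sum_ite_mem, univ_inter, sum_const,
    nsmul_eq_mul, ne_eq, OfNat.ofNat_ne_zero, not_false_eq_true, zero_pow]
  field_simp
  norm_num

end Walsh

theorem cubeNorm_one {N : ℕ} (g : (Fin N → Bool) → ℝ) :
    cubeNorm N 1 g = cubeE N fun x => |g x| := by
  simp [cubeNorm]

theorem cubeNorm_two {N : ℕ} (g : (Fin N → Bool) → ℝ) :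
    cubeNorm N 2 g = √(cubeE N fun x => g x ^ 2) := by
  simp [cubeNorm, Real.sqrt_eq_rpow]

theorem exists_three_pow_le {R : ℝ} (hR : 1 ≤ R) :
    ∃ m : ℕ, 3 ^ m / R + 1 / (m + 1) ≤ 7 / (1 + Real.log R) := by
  have hL : 0 ≤ Real.log R := Real.log_nonneg hR
  have hR' : Real.exp (Real.log R) = R := Real.exp_log (by linarith)
  set L := Real.log R
  refine ⟨⌊L / 4⌋₊, ?_⟩
  set m := ⌊L / 4⌋₊
  have hm1 : (m : ℝ) ≤ L / 4 := Nat.floor_le (by positivity)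
  have hm2 : L / 4 < m + 1 := Nat.lt_floor_add_one _
  have hm0 : (0 : ℝ) ≤ m := m.cast_nonneg
  have hthree : (3 : ℝ) ^ m ≤ Real.exp (L / 2) :=
    calc (3 : ℝ) ^ m ≤ Real.exp 2 ^ m := by
          gcongr
          linarith [Real.add_one_le_exp 2]
      _ = Real.exp (m * 2) := (Real.exp_nat_mul 2 m).symm
      _ ≤ _ := Real.exp_le_exp.mpr (by linarith)
  have h1 : 3 ^ m / R ≤ 2 / (1 + L) := by
    rw [div_le_div_iff₀ (by linarith) (by linarith)]
    have he : R = Real.exp (L / 2) * Real.exp (L / 2) := by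
      rw [← Real.exp_add, add_halves, hR']
    rw [he, mul_left_comm]
    exact mul_le_mul hthree (by linarith [Real.add_one_le_exp (L / 2)]) (by linarith)
      (Real.exp_pos _).le
  have h2 : 1 / ((m : ℝ) + 1) ≤ 5 / (1 + L) := by
    rw [div_le_div_iff₀ (by linarith) (by linarith)]
    linarith
  calc _ ≤ 2 / (1 + L) + 5 / (1 + L) := add_le_add h1 h2
    _ = _ := by ring

theorem sum_walshCoeff_sq_div_card_le_log {N : ℕ} (g : (Fin N → Bool) → ℝ) :
    ∑ S, walshCoeff g S ^ 2 / #S ≤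
      7 * if cubeNorm N 1 g = 0 then 0 else
        cubeNorm N 2 g ^ 2 / (1 + Real.log (cubeNorm N 2 g / cubeNorm N 1 g)) := by
  have hbound := sum_walshCoeff_sq_div_card_le g
  have hg0 : 0 ≤ cubeE N (fun x => |g x|) := cubeE_nonneg fun x => abs_nonneg _
  have hg2 : 0 ≤ cubeE N (fun x => g x ^ 2) := cubeE_nonneg fun x => sq_nonneg _
  rw [cubeNorm_one, cubeNorm_two]
  split_ifs with h
  · have hz : ∀ x, g x = 0 := by
      have hs : ∑ x, |g x| = 0 := by
        simpa [cubeE] using h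
      simpa [sum_eq_zero_iff_of_nonneg] using hs
    simp [walshCoeff, cubeE, hz]
  · have hpos : 0 < cubeE N (fun x => |g x|) := lt_of_le_of_ne hg0 (Ne.symm h)
    have hle : cubeE N (fun x => |g x|) ≤ √(cubeE N fun x => g x ^ 2) := by
      refine Real.le_sqrt_of_sq_le ?_
      simpa [cubeE] using cubeE_mul_sq_le (fun x => |g x|) fun _ => 1
    obtain ⟨m, hm⟩ := exists_three_pow_le ((one_le_div hpos).mpr hle)
    refine (hbound m).trans ?_
    nth_rewrite 2 [← Real.sq_sqrt hg2]
    set p := cubeE N (fun x => |g x|)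
    set q := √(cubeE N fun x => g x ^ 2)
    have hq : 0 < q := hpos.trans_le hle
    calc 3 ^ m * (p * q) + q ^ 2 / (m + 1) = q ^ 2 * (3 ^ m / (q / p) + 1 / (m + 1)) := by
          field_simp
      _ ≤ q ^ 2 * (7 / (1 + Real.log (q / p))) := by gcongr
      _ = _ := by ring

/-- Talagrand's inequality on the discrete cube. -/
theorem stmt0 :
    ∃ C : ℝ, 1 ≤ C ∧ ∀ N : ℕ, 1 ≤ N → ∀ f : (Fin N → Bool) → ℝ,
      cubeVar N f ≤ C * ∑ i : Fin N,
        if cubeNorm N 1 (cubeD N i f) = 0 then 0 else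
          cubeNorm N 2 (cubeD N i f) ^ 2 /
            (1 + Real.log (cubeNorm N 2 (cubeD N i f) / cubeNorm N 1 (cubeD N i f))) := by
  refine ⟨7, by norm_num, fun N _ f => ?_⟩
  rw [cubeVar_eq_sum_walshCoeff_cubeD, mul_sum, mul_sum]
  refine sum_le_sum fun i _ => le_trans ?_ (sum_walshCoeff_sq_div_card_le_log (cubeD N i f))
  have : 0 ≤ ∑ S, walshCoeff (cubeD N i f) S ^ 2 / #S := sum_nonneg fun S _ => by positivity
  linarith
end

section
/- There exists a numerical constant C ≥ 1 such that for every N ≥ 2 and every subset A ⊆ {-1,+1}^N with μ(A) = a ∈ (0,1), there is a coordinate i, 1 ≤ i ≤ N, with I_i(A) ≥ (a(1−a)/(8CN)) · log(N/(a(1−a))); in particular I_i(A) ≥ a(1−a) log N / (8CN). -/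
/-- Uniform probability measure of a subset of the discrete cube `{-1,+1}^N`,
modeled as `Fin N → Bool`. -/
noncomputable def cubeMeas (N : ℕ) (A : Finset (Fin N → Bool)) : ℝ :=
  (A.card : ℝ) / 2 ^ N

/-- Influence of the `i`-th coordinate on `A`:
`I_i(A) = μ({x ∈ A : τ_i x ∉ A})` where `τ_i` flips the `i`-th coordinate. -/
noncomputable def cubeInfl (N : ℕ) (i : Fin N) (A : Finset (Fin N → Bool)) : ℝ :=
  ((A.filter fun x => Function.update x i (!x i) ∉ A).card : ℝ) / 2 ^ N

namespace DiscreteCube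

open Finset

/-- Flip the `i`-th coordinate of a point of the cube. -/
def flip {n : ℕ} (i : Fin n) (x : Fin n → Bool) : Fin n → Bool :=
  Function.update x i (!x i)

/-- Expectation for the uniform measure on the cube. -/
noncomputable def mean {n : ℕ} (f : (Fin n → Bool) → ℝ) : ℝ :=
  (∑ x, f x) / 2 ^ n

/-- Total squared discrete gradient. -/
noncomputable def energy {n : ℕ} (f : (Fin n → Bool) → ℝ) : ℝ :=
  ∑ i, mean fun x => (f x - f (flip i x)) ^ 2

/-- Restriction of a function on the cube to a face orthogonal to the first coordinate. -/
def face {n : ℕ} (b : Bool) (f : (Fin (n + 1) → Bool) → ℝ) (x : Fin n → Bool) : ℝ :=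
  f (Fin.cons b x)

theorem flip_involutive {n : ℕ} (i : Fin n) : Function.Involutive (flip i) := by
  intro x
  simp [flip]

theorem flip_zero_cons {n : ℕ} (b : Bool) (x : Fin n → Bool) :
    flip 0 (Fin.cons b x : Fin (n + 1) → Bool) = Fin.cons (!b) x := by
  simp [flip]

theorem flip_succ_cons {n : ℕ} (i : Fin n) (b : Bool) (x : Fin n → Bool) :
    flip i.succ (Fin.cons b x : Fin (n + 1) → Bool) = Fin.cons b (flip i x) := by
  simp [flip]

theorem mean_succ {n : ℕ} (f : (Fin (n + 1) → Bool) → ℝ) :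
    mean f = ((mean fun x => f (Fin.cons false x)) + mean fun x => f (Fin.cons true x)) / 2 := by
  unfold mean
  rw [← (Fin.consEquiv fun _ : Fin (n + 1) => Bool).sum_comp, Fintype.sum_prod_type]
  rw [Fintype.sum_bool, pow_succ, ← add_div, div_div, add_comm]
  rfl

theorem mean_zero (f : (Fin 0 → Bool) → ℝ) : mean f = f default := by
  rw [mean, Fintype.sum_unique, pow_zero, div_one]
  exact congrArg f (Subsingleton.elim _ _)

theorem mean_add {n : ℕ} (f g : (Fin n → Bool) → ℝ) :
    mean (fun x => f x + g x) = mean f + mean g := by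
  simp [mean, sum_add_distrib, add_div]

theorem mean_sub {n : ℕ} (f g : (Fin n → Bool) → ℝ) :
    mean (fun x => f x - g x) = mean f - mean g := by
  simp [mean, sum_sub_distrib, sub_div]

theorem mean_const_mul {n : ℕ} (c : ℝ) (f : (Fin n → Bool) → ℝ) :
    mean (fun x => c * f x) = c * mean f := by
  simp [mean, ← mul_sum, mul_div_assoc]

theorem mean_mono {n : ℕ} {f g : (Fin n → Bool) → ℝ} (h : ∀ x, f x ≤ g x) :
    mean f ≤ mean g := by
  unfold mean
  gcongr
  exact h _

theorem mean_nonneg {n : ℕ} {f : (Fin n → Bool) → ℝ} (h : ∀ x, 0 ≤ f x) : 0 ≤ mean f :=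
  div_nonneg (sum_nonneg fun x _ => h x) (by positivity)

theorem mean_comp_flip {n : ℕ} (i : Fin n) (f : (Fin n → Bool) → ℝ) :
    mean (fun x => f (flip i x)) = mean f := by
  unfold mean
  exact congrArg (· / 2 ^ n) (Equiv.sum_comp (flip_involutive i).toPerm f)

theorem mean_mul_sq_le {n : ℕ} (f g : (Fin n → Bool) → ℝ) :
    mean (fun x => f x * g x) ^ 2 ≤ mean (fun x => f x ^ 2) * mean (fun x => g x ^ 2) := by
  unfold mean
  rw [div_pow, div_mul_div_comm, ← sq]
  gcongr
  exact sum_mul_sq_le_sq_mul_sq _ _ _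

theorem sq_sqrt_mean_sub_le {n : ℕ} (f g : (Fin n → Bool) → ℝ) :
    (√(mean fun x => f x ^ 2) - √(mean fun x => g x ^ 2)) ^ 2 ≤
      mean fun x => (f x - g x) ^ 2 := by
  have hf : 0 ≤ mean fun x => f x ^ 2 := mean_nonneg fun x => sq_nonneg _
  have hg : 0 ≤ mean fun x => g x ^ 2 := mean_nonneg fun x => sq_nonneg _
  have hfg : mean (fun x => f x * g x) ≤
      √(mean fun x => f x ^ 2) * √(mean fun x => g x ^ 2) := by
    rw [← Real.sqrt_mul hf]
    exact Real.le_sqrt_of_sq_le (mean_mul_sq_le f g)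
  have hexp : (mean fun x => (f x - g x) ^ 2) =
      mean (fun x => f x ^ 2) + mean (fun x => g x ^ 2) - 2 * mean (fun x => f x * g x) := by
    rw [← mean_const_mul, ← mean_add, ← mean_sub]
    congr 1
    ext x
    ring
  rw [hexp, sub_sq, Real.sq_sqrt hf, Real.sq_sqrt hg]
  linarith

theorem energy_succ {n : ℕ} (f : (Fin (n + 1) → Bool) → ℝ) :
    energy f = mean (fun x => (face false f x - face true f x) ^ 2) +
      (energy (face false f) + energy (face true f)) / 2 := by
  unfold energy
  rw [Fin.sum_univ_succ, ← sum_add_distrib, sum_div]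
  congr 1
  · rw [mean_succ]
    simp only [face, flip_zero_cons, Bool.not_false, Bool.not_true]
    simp only [sub_sq_comm (f (Fin.cons true _))]
    ring
  · refine sum_congr rfl fun i _ => ?_
    rw [mean_succ]
    simp only [face, flip_succ_cons]

theorem mul_log_div_ge {x r : ℝ} (hx : 0 ≤ x) (hr : 0 < r) :
    x - r ≤ x * (Real.log x - Real.log r) := by
  rcases hx.eq_or_lt with rfl | hx
  · simpa using hr.le
  · have h := Real.log_le_sub_one_of_pos (div_pos hr hx)
    rw [Real.log_div hr.ne' hx.ne'] at h
    have h2 : x * (r / x) = r := by field_simp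
    nlinarith

theorem two_point_log_sobolev {s t : ℝ} (hs : 0 ≤ s) (ht : 0 ≤ t) :
    (s * Real.log s + t * Real.log t) / 2 ≤
      (s + t) / 2 * Real.log ((s + t) / 2) + (√s - √t) ^ 2 := by
  rcases (add_nonneg hs ht).eq_or_lt with h | h
  · obtain rfl : s = 0 := by linarith
    obtain rfl : t = 0 := by linarith
    simp
  have hm : 0 < (s + t) / 2 := by positivity
  have key : ∀ u : ℝ, 0 ≤ u →
      u * Real.log u ≤ u * Real.log ((s + t) / 2) + u * (u / ((s + t) / 2) - 1) := by
    intro u hu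
    rcases hu.eq_or_lt with rfl | hu
    · simp
    · have h := Real.log_le_sub_one_of_pos (div_pos hu hm)
      rw [Real.log_div hu.ne' hm.ne'] at h
      nlinarith
  have h1 := key s hs
  have h2 := key t ht
  have h3 : (s * (s / ((s + t) / 2) - 1) + t * (t / ((s + t) / 2) - 1)) / 2 ≤
      (√s - √t) ^ 2 := by
    have e : (s * (s / ((s + t) / 2) - 1) + t * (t / ((s + t) / 2) - 1)) / 2 =
        (s - t) ^ 2 / (2 * (s + t)) := by
      field_simp
      ring
    rw [e, div_le_iff₀ (by positivity)]
    have e2 : (s - t) ^ 2 = (√s - √t) ^ 2 * (√s + √t) ^ 2 := by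
      rw [← mul_pow]
      congr 1
      nlinarith [Real.sq_sqrt hs, Real.sq_sqrt ht]
    rw [e2]
    gcongr
    nlinarith [Real.sq_sqrt hs, Real.sq_sqrt ht, sq_nonneg (√s - √t)]
  linarith

/-- Logarithmic Sobolev inequality on the discrete cube, without the optimal constant. -/
theorem log_sobolev {n : ℕ} (g : (Fin n → Bool) → ℝ) :
    mean (fun x => g x ^ 2 * Real.log (g x ^ 2)) ≤
      mean (fun x => g x ^ 2) * Real.log (mean fun x => g x ^ 2) + energy g := by
  induction n with
  | zero => simp [mean_zero, energy]
  | succ n ih =>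
    have h0 := ih (face false g)
    have h1 := ih (face true g)
    have h2 := two_point_log_sobolev
      (mean_nonneg (f := fun x => face false g x ^ 2) fun x => sq_nonneg _)
      (mean_nonneg (f := fun x => face true g x ^ 2) fun x => sq_nonneg _)
    have h3 := sq_sqrt_mean_sub_le (face false g) (face true g)
    rw [energy_succ, mean_succ, mean_succ fun x => g x ^ 2]
    simp only [face] at *
    linarith

/-- Functions with small `L¹` norm compared to their `L²` norm have large energy. -/
theorem mean_sq_mul_log_le_energy {n : ℕ} (g : (Fin n → Bool) → ℝ) {r δ : ℝ} (hr : 0 < r)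
    (hδ : 0 < δ) (hg : mean (fun x => |g x|) ≤ δ) :
    mean (fun x => g x ^ 2) * (Real.log r - 2 * Real.log δ + 1) - r ≤ energy g := by
  set V := mean fun x => g x ^ 2 with hV
  have hV0 : 0 ≤ V := mean_nonneg fun x => sq_nonneg _
  have hE : 0 ≤ energy g := sum_nonneg fun i _ => mean_nonneg fun x => sq_nonneg _
  rcases hV0.eq_or_lt with h | hVpos
  · rw [← h]
    linarith
  have hs : 0 < V / δ := by positivity
  have hent : 2 * Real.log (V / δ) * V + 2 * (V - V / δ * mean fun x => |g x|) ≤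
      mean fun x => g x ^ 2 * Real.log (g x ^ 2) := by
    rw [hV, ← hV, ← mean_const_mul (V / δ), hV, ← mean_sub, ← mean_const_mul, ← mean_const_mul,
      ← mean_add]
    refine mean_mono fun x => ?_
    have := mul_le_mul_of_nonneg_left (mul_log_div_ge (abs_nonneg (g x)) hs) (abs_nonneg (g x))
    rw [← sq_abs (g x), Real.log_pow]
    push_cast
    nlinarith
  have hL1 : V / δ * mean (fun x => |g x|) ≤ V := by
    calc V / δ * mean (fun x => |g x|) ≤ V / δ * δ := by gcongr
      _ = V := by field_simp
  have hls := log_sobolev g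
  rw [← hV] at hls
  rw [Real.log_div hVpos.ne' hδ.ne'] at hent
  have := mul_log_div_ge hV0 hr
  nlinarith

/-- Falik–Samorodnitsky type inequality: a function with small `L¹` partial derivatives has large
energy compared to its variance. -/
theorem variance_mul_log_le_energy {n : ℕ} (f : (Fin n → Bool) → ℝ) {r δ : ℝ} (hr : 0 < r)
    (hδ : 0 < δ) (hf : ∀ i, mean (fun x => |f x - f (flip i x)|) ≤ 2 * δ) :
    (mean (fun x => f x ^ 2) - mean f ^ 2) * (Real.log r - 2 * Real.log δ + 1) - n * r ≤
      energy f := by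
  induction n with
  | zero => simp [mean_zero, energy]
  | succ n ih =>
    set F : (Fin n → Bool) → ℝ := fun x => (1 / 2) * (face false f x + face true f x) with hF
    set h : (Fin n → Bool) → ℝ := fun x => (1 / 2) * (face false f x - face true f x) with hh
    have hF1 : ∀ i, mean (fun x => |F x - F (flip i x)|) ≤ 2 * δ := by
      intro i
      refine le_trans ?_ (hf i.succ)
      rw [mean_succ, ← mean_add, div_eq_inv_mul, ← mean_const_mul]
      refine mean_mono fun x => ?_
      simp only [hF, face, flip_succ_cons]
      rw [← mul_sub, abs_mul, abs_of_pos (by norm_num : (0 : ℝ) < 1 / 2), add_sub_add_comm]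
      have := abs_add_le (f (Fin.cons false x) - f (Fin.cons false (flip i x)))
        (f (Fin.cons true x) - f (Fin.cons true (flip i x)))
      linarith
    have hh1 : mean (fun x => |h x|) ≤ δ := by
      have h0 := hf 0
      rw [mean_succ] at h0
      simp only [flip_zero_cons, Bool.not_false, Bool.not_true] at h0
      simp only [abs_sub_comm (f (Fin.cons true _))] at h0
      simp only [hh, abs_mul, mean_const_mul, face]
      rw [abs_of_pos (by norm_num : (0 : ℝ) < 1 / 2)]
      linarith
    have hmean : mean f = mean F := by
      simp only [hF, face]
      rw [mean_const_mul, mean_add, mean_succ]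
      ring
    have hsq : mean (fun x => f x ^ 2) = mean (fun x => F x ^ 2) + mean (fun x => h x ^ 2) := by
      rw [mean_succ, ← mean_add, ← mean_add, div_eq_inv_mul, ← mean_const_mul]
      congr 1
      ext x
      simp only [hF, hh, face]
      ring
    have henergy : energy F + energy h ≤ energy f := by
      have e : energy F + energy h = (energy (face false f) + energy (face true f)) / 2 := by
        unfold energy
        rw [← sum_add_distrib, ← sum_add_distrib, sum_div]
        refine sum_congr rfl fun i _ => ?_
        rw [← mean_add, ← mean_add, div_eq_inv_mul, ← mean_const_mul]
        congr 1
        ext x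
        simp only [hF, hh]
        ring
      rw [e, energy_succ]
      have : 0 ≤ mean fun x => (face false f x - face true f x) ^ 2 :=
        mean_nonneg fun x => sq_nonneg _
      linarith
    have h1 := ih F hF1
    have h2 := mean_sq_mul_log_le_energy h hr hδ hh1
    rw [hmean, hsq]
    push_cast
    linarith

/-- The real-valued indicator function of a subset of the cube. -/
def indic {n : ℕ} (A : Finset (Fin n → Bool)) (x : Fin n → Bool) : ℝ :=
  if x ∈ A then 1 else 0

theorem indic_sq {n : ℕ} (A : Finset (Fin n → Bool)) (x : Fin n → Bool) :
    indic A x ^ 2 = indic A x := by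
  unfold indic
  split_ifs <;> simp

theorem mean_indic {n : ℕ} (A : Finset (Fin n → Bool)) : mean (indic A) = cubeMeas n A := by
  simp [mean, indic, cubeMeas]

theorem mean_indic_boundary {n : ℕ} (i : Fin n) (A : Finset (Fin n → Bool)) :
    mean (indic (A.filter fun x => flip i x ∉ A)) = cubeInfl n i A := by
  rw [mean_indic]
  rfl

theorem mean_abs_indic_sub {n : ℕ} (i : Fin n) (A : Finset (Fin n → Bool)) :
    mean (fun x => |indic A x - indic A (flip i x)|) = 2 * cubeInfl n i A := by
  set B := A.filter fun x => flip i x ∉ A with hB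
  have h : ∀ x, |indic A x - indic A (flip i x)| = indic B x + indic B (flip i x) := by
    intro x
    simp only [indic, hB, mem_filter, flip_involutive i x]
    by_cases h1 : x ∈ A <;> by_cases h2 : flip i x ∈ A <;> simp [h1, h2]
  simp only [h]
  rw [mean_add, mean_comp_flip i (indic B), mean_indic_boundary]
  ring

theorem energy_indic {n : ℕ} (A : Finset (Fin n → Bool)) :
    energy (indic A) = ∑ i, 2 * cubeInfl n i A := by
  refine sum_congr rfl fun i _ => ?_
  rw [← mean_abs_indic_sub]
  congr 1
  ext x
  unfold indic
  split_ifs <;> simp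

theorem exists_influence_ge {N : ℕ} (hN : 2 ≤ N) (A : Finset (Fin N → Bool))
    (h0 : 0 < cubeMeas N A) (h1 : cubeMeas N A < 1) :
    ∃ i, cubeMeas N A * (1 - cubeMeas N A) / (8 * N) *
      Real.log (N / (cubeMeas N A * (1 - cubeMeas N A))) ≤ cubeInfl N i A := by
  set a := cubeMeas N A with ha
  set v := a * (1 - a) with hv
  have hv0 : 0 < v := mul_pos h0 (by linarith)
  have hv1 : v < 1 := by nlinarith
  have hN0 : (0 : ℝ) < N := by
    have : 0 < N := by omega
    exact_mod_cast this
  have hN2 : (2 : ℝ) ≤ N := by exact_mod_cast hN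
  set L := Real.log (N / v) with hL
  have hL0 : 0 < L := Real.log_pos (by rw [lt_div_iff₀ hv0]; linarith)
  by_contra! hlt
  set δ := v / (8 * N) * L with hδ
  have hδ0 : 0 < δ := by positivity
  have hmain := variance_mul_log_le_energy (indic A) (r := v / N) (δ := δ) (by positivity) hδ0
    fun i => by
      rw [mean_abs_indic_sub]
      linarith [hlt i]
  have henergy : energy (indic A) ≤ N * (2 * δ) := by
    rw [energy_indic]
    calc ∑ i, 2 * cubeInfl N i A ≤ ∑ _i : Fin N, 2 * δ :=
          sum_le_sum fun i _ => by linarith [hlt i]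
      _ = N * (2 * δ) := by simp
  have hvar : mean (fun x => indic A x ^ 2) - mean (indic A) ^ 2 = v := by
    simp only [indic_sq]
    rw [mean_indic, hv, ← ha]
    ring
  have hNδ : N * (2 * δ) = v * L / 4 := by
    rw [hδ]
    field_simp
    norm_num
  have hNr : N * (v / N) = v := by field_simp
  have hlogδ : Real.log δ = Real.log (L / 8) - L := by
    have : δ = L / 8 / (N / v) := by
      rw [hδ]
      field_simp
    rw [this, Real.log_div (by positivity) (by positivity)]
  have hlogr : Real.log (v / N) = -L := by
    rw [hL, ← Real.log_inv, inv_div]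
  have hlogL : Real.log (L / 8) ≤ L / 8 - 1 := Real.log_le_sub_one_of_pos (by positivity)
  rw [hvar, hNr, hlogδ, hlogr] at hmain
  have hcontra : v * (L - 2 * Real.log (L / 8)) ≤ v * (L / 4) := by linarith
  have := le_of_mul_le_mul_left hcontra hv0
  linarith

end DiscreteCube

/-- The Kahn-Kalai-Linial theorem: existence of a coordinate of influence at
least of order `a(1-a) log N / N`. -/
theorem stmt2 :
    ∃ C : ℝ, 1 ≤ C ∧ ∀ N : ℕ, 2 ≤ N → ∀ A : Finset (Fin N → Bool), ∀ a : ℝ,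
      cubeMeas N A = a → 0 < a → a < 1 →
      ∃ i : Fin N,
        cubeInfl N i A ≥ a * (1 - a) / (8 * C * N) * Real.log (N / (a * (1 - a))) ∧
        cubeInfl N i A ≥ a * (1 - a) * Real.log N / (8 * C * N) := by
  refine ⟨1, le_rfl, ?_⟩
  rintro N hN A a rfl h0 h1
  obtain ⟨i, hi⟩ := DiscreteCube.exists_influence_ge hN A h0 h1
  have hN0 : (0 : ℝ) < N := by
    have : 0 < N := by omega
    exact_mod_cast this
  have hv0 : 0 < cubeMeas N A * (1 - cubeMeas N A) := mul_pos h0 (by linarith)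
  have hv1 : cubeMeas N A * (1 - cubeMeas N A) ≤ 1 := by nlinarith
  refine ⟨i, by rwa [mul_one], ?_⟩
  refine le_trans ?_ hi
  rw [mul_one, mul_div_right_comm]
  gcongr
  exact le_div_self hN0.le hv0 hv1
end

section
/- There exists a numerical constant C > 0 such that for every N ≥ 1, every p ∈ (0,1) with q = 1 − p, p ≠ q, and every function f : {-1,+1}^N → ℝ, Var_μ(f) ≤ (C p q (log p − log q)/(p − q)) · Σ_{i=1}^N ‖D_i f‖₂² / (1 + log(‖D_i f‖₂ / (2√(pq) ‖D_i f‖₁))), where summands with ‖D_i f‖₁ = 0 are interpreted as 0. -/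
/-- Expectation with respect to the product measure `(p δ_{+1} + q δ_{-1})^{⊗N}`
on the discrete cube `{-1,+1}^N`, modeled as `Fin N → Bool` (`true = +1`). -/
noncomputable def bcubeE (N : ℕ) (p : ℝ) (g : (Fin N → Bool) → ℝ) : ℝ :=
  ∑ x : Fin N → Bool, (∏ i : Fin N, if x i then p else 1 - p) * g x

/-- `L^r(μ)` norm with respect to the biased measure. -/
noncomputable def bcubeNorm (N : ℕ) (p r : ℝ) (g : (Fin N → Bool) → ℝ) : ℝ :=
  (bcubeE N p fun x => |g x| ^ r) ^ (1 / r)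

/-- Variance with respect to the biased measure. -/
noncomputable def bcubeVar (N : ℕ) (p : ℝ) (f : (Fin N → Bool) → ℝ) : ℝ :=
  bcubeE N p (fun x => f x ^ 2) - (bcubeE N p f) ^ 2

/-- `D_i f (x) = f(τ_i x) - f(x)`, where `τ_i` flips the `i`-th coordinate. -/
def bcubeD (N : ℕ) (i : Fin N) (f : (Fin N → Bool) → ℝ) (x : Fin N → Bool) : ℝ :=
  f (Function.update x i (!x i)) - f x

namespace BiasedCube

variable {N : ℕ} {p : ℝ}

/-- The normalised (mean zero, variance one) coordinate function. -/
noncomputable def coord (p : ℝ) (b : Bool) : ℝ :=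
  (if b then 1 - p else -p) / √(p * (1 - p))

/-- The biased Walsh function indexed by `S`. -/
noncomputable def walsh (p : ℝ) (S : Finset (Fin N)) (x : Fin N → Bool) : ℝ :=
  ∏ i ∈ S, coord p (x i)

/-- The biased Fourier–Walsh coefficient of `f` at `S`. -/
noncomputable def coeff (p : ℝ) (f : (Fin N → Bool) → ℝ) (S : Finset (Fin N)) : ℝ :=
  bcubeE N p fun x => f x * walsh p S x

/-- Averaging over the `i`-th coordinate. -/
noncomputable def avg (p : ℝ) (i : Fin N) (f : (Fin N → Bool) → ℝ) (x : Fin N → Bool) : ℝ :=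
  p * f (Function.update x i true) + (1 - p) * f (Function.update x i false)

lemma weight_nonneg (hp : 0 < p) (hp1 : p < 1) (x : Fin N → Bool) :
    0 ≤ ∏ i : Fin N, if x i then p else 1 - p :=
  Finset.prod_nonneg fun i _ => by split_ifs <;> linarith

lemma expect_mono (hp : 0 < p) (hp1 : p < 1) {f g : (Fin N → Bool) → ℝ} (h : ∀ x, f x ≤ g x) :
    bcubeE N p f ≤ bcubeE N p g :=
  Finset.sum_le_sum fun x _ => mul_le_mul_of_nonneg_left (h x) (weight_nonneg hp hp1 x)

lemma expect_nonneg (hp : 0 < p) (hp1 : p < 1) {f : (Fin N → Bool) → ℝ} (h : ∀ x, 0 ≤ f x) :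
    0 ≤ bcubeE N p f :=
  Finset.sum_nonneg fun x _ => mul_nonneg (weight_nonneg hp hp1 x) (h x)

lemma expect_add (f g : (Fin N → Bool) → ℝ) :
    bcubeE N p (fun x => f x + g x) = bcubeE N p f + bcubeE N p g := by
  simp only [bcubeE, mul_add, Finset.sum_add_distrib]

lemma expect_const_mul (c : ℝ) (f : (Fin N → Bool) → ℝ) :
    bcubeE N p (fun x => c * f x) = c * bcubeE N p f := by
  simp only [bcubeE, Finset.mul_sum]
  exact Finset.sum_congr rfl fun x _ => by ring

lemma expect_sum {ι : Type*} (s : Finset ι) (f : ι → (Fin N → Bool) → ℝ) :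
    bcubeE N p (fun x => ∑ k ∈ s, f k x) = ∑ k ∈ s, bcubeE N p (f k) := by
  simp only [bcubeE, Finset.mul_sum]
  exact Finset.sum_comm

lemma expect_one : bcubeE N p (fun _ => 1) = 1 := by
  have h := Finset.prod_univ_sum (fun _ : Fin N => (Finset.univ : Finset Bool))
    (fun _ b => if b then p else 1 - p)
  simp only [Fintype.piFinset_univ] at h
  simp only [bcubeE, mul_one]
  rw [← h]
  simp

lemma expect_const (c : ℝ) : bcubeE N p (fun _ => c) = c := by
  simpa [expect_one] using expect_const_mul (N := N) (p := p) c (fun _ => 1)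

lemma expect_mul_sq_le (hp : 0 < p) (hp1 : p < 1) (f g : (Fin N → Bool) → ℝ) :
    bcubeE N p (fun x => f x * g x) ^ 2 ≤
      bcubeE N p (fun x => f x ^ 2) * bcubeE N p (fun x => g x ^ 2) := by
  refine Finset.sum_sq_le_sum_mul_sum_of_sq_le_mul _ (fun x _ => ?_) (fun x _ => ?_)
    fun x _ => le_of_eq ?_
  · exact mul_nonneg (weight_nonneg hp hp1 x) (sq_nonneg _)
  · exact mul_nonneg (weight_nonneg hp hp1 x) (sq_nonneg _)
  · ring

lemma sum_flip (i : Fin N) (g : (Fin N → Bool) → ℝ) :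
    ∑ x, g (Function.update x i (!x i)) = ∑ x, g x := by
  have hinv : Function.Involutive fun x : Fin N → Bool => Function.update x i (!x i) := by
    intro x
    simp
  exact Equiv.sum_comp hinv.toPerm g

lemma sum_eq_half_sum_update (i : Fin N) (g : (Fin N → Bool) → ℝ) :
    ∑ x, g x = 1 / 2 * ∑ x, (g (Function.update x i true) + g (Function.update x i false)) := by
  have h : ∀ x : Fin N → Bool, g (Function.update x i true) + g (Function.update x i false) =
      g x + g (Function.update x i (!x i)) := by
    intro x
    have hx : Function.update x i (x i) = x := Function.update_eq_self i x
    cases hb : x i <;> rw [hb] at hx <;> simp [hx, add_comm]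
  simp only [h, Finset.sum_add_distrib, sum_flip]
  ring

lemma weight_update (i : Fin N) (x : Fin N → Bool) (b : Bool) :
    (∏ j : Fin N, if Function.update x i b j then p else 1 - p) =
      (if b then p else 1 - p) * ∏ j ∈ Finset.univ.erase i, if x j then p else 1 - p := by
  rw [← Finset.mul_prod_erase _ _ (Finset.mem_univ i)]
  congr 1
  · simp
  · refine Finset.prod_congr rfl fun j hj => ?_
    rw [Function.update_of_ne (Finset.ne_of_mem_erase hj)]

lemma avg_update (i : Fin N) (f : (Fin N → Bool) → ℝ) (x : Fin N → Bool) (b : Bool) :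
    avg p i f (Function.update x i b) = avg p i f x := by
  simp [avg]

lemma expect_avg (i : Fin N) (f : (Fin N → Bool) → ℝ) :
    bcubeE N p (avg p i f) = bcubeE N p f := by
  unfold bcubeE
  rw [sum_eq_half_sum_update i, sum_eq_half_sum_update i (fun x => _ * f x)]
  congr 1
  refine Finset.sum_congr rfl fun x _ => ?_
  simp only [avg_update, weight_update]
  simp only [avg, if_true, Bool.false_eq_true, if_false]
  ring

lemma walsh_update_of_notMem {S : Finset (Fin N)} {i : Fin N} (hi : i ∉ S) (x : Fin N → Bool)
    (b : Bool) : walsh p S (Function.update x i b) = walsh p S x := by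
  refine Finset.prod_congr rfl fun j hj => ?_
  rw [Function.update_of_ne]
  rintro rfl
  exact hi hj

lemma walsh_insert {S : Finset (Fin N)} {i : Fin N} (hi : i ∉ S) (x : Fin N → Bool) :
    walsh p (insert i S) x = coord p (x i) * walsh p S x :=
  Finset.prod_insert hi

lemma sqrt_variance_pos (hp : 0 < p) (hp1 : p < 1) : 0 < √(p * (1 - p)) :=
  Real.sqrt_pos.2 (mul_pos hp (by linarith))

lemma sq_sqrt_variance (hp : 0 < p) (hp1 : p < 1) : √(p * (1 - p)) ^ 2 = p * (1 - p) :=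
  Real.sq_sqrt (mul_pos hp (by linarith)).le

lemma one_add_coord_mul (hp : 0 < p) (hp1 : p < 1) (a b : Bool) :
    (if a then p else 1 - p) * (1 + coord p a * coord p b) = if a = b then 1 else 0 := by
  have h1 := sqrt_variance_pos hp hp1
  have h2 := sq_sqrt_variance hp hp1
  unfold coord
  generalize √(p * (1 - p)) = σ at h1 h2
  cases a <;> cases b <;> simp only [Bool.false_eq_true, reduceCtorEq, if_true, if_false] <;>
    field_simp <;> rw [h2] <;> ring

lemma sum_walsh_mul_walsh (hp : 0 < p) (hp1 : p < 1) (x y : Fin N → Bool) :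
    (∏ i : Fin N, if x i then p else 1 - p) * ∑ S, walsh p S x * walsh p S y =
      if x = y then 1 else 0 := by
  have h : ∑ S, walsh p S x * walsh p S y = ∏ i, (1 + coord p (x i) * coord p (y i)) := by
    rw [Finset.prod_one_add, Finset.powerset_univ]
    exact Finset.sum_congr rfl fun S _ => Finset.prod_mul_distrib.symm
  rw [h, ← Finset.prod_mul_distrib]
  simp only [one_add_coord_mul hp hp1, Finset.prod_ite_zero, funext_iff, Finset.mem_univ,
    forall_true_left, Finset.prod_const_one]

/-- Parseval's identity. -/
lemma sum_coeff_sq (hp : 0 < p) (hp1 : p < 1) (f : (Fin N → Bool) → ℝ) :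
    ∑ S, coeff p f S ^ 2 = bcubeE N p (fun x => f x ^ 2) := by
  have h : ∀ S : Finset (Fin N), coeff p f S ^ 2 = ∑ x, ∑ y,
      (∏ i : Fin N, if y i then p else 1 - p) * f x * f y *
        ((∏ i : Fin N, if x i then p else 1 - p) * (walsh p S x * walsh p S y)) := by
    intro S
    rw [sq, coeff, bcubeE, Finset.sum_mul_sum]
    exact Finset.sum_congr rfl fun x _ => Finset.sum_congr rfl fun y _ => by ring
  simp only [h]
  rw [Finset.sum_comm, bcubeE]
  refine Finset.sum_congr rfl fun x _ => ?_
  rw [Finset.sum_comm]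
  simp only [← Finset.mul_sum, sum_walsh_mul_walsh hp hp1, mul_ite, mul_one, mul_zero,
    Finset.sum_ite_eq, Finset.mem_univ, if_true]
  ring

lemma two_point_le (hp : 0 < p) (hp1 : p < 1) {ρ : ℝ} (h2 : ρ ^ 2 ≤ 1 / 4)
    (h4 : 3 * ρ ^ 4 ≤ p * (1 - p)) (g h : ℝ) :
    p * (g + ρ * coord p true * h) ^ 4 + (1 - p) * (g + ρ * coord p false * h) ^ 4 ≤
      (g ^ 2 + h ^ 2) ^ 2 := by
  have hs := sqrt_variance_pos hp hp1
  have hs2 := sq_sqrt_variance hp hp1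
  have hq : 0 < p * (1 - p) := mul_pos hp (by linarith)
  obtain ⟨y, hy⟩ : ∃ y, y = ρ * h / √(p * (1 - p)) := ⟨_, rfl⟩
  have e1 : ρ * coord p true * h = (1 - p) * y := by simp [coord, hy]; ring
  have e2 : ρ * coord p false * h = -p * y := by simp [coord, hy]; ring
  have e3 : p * (1 - p) * y ^ 2 = ρ ^ 2 * h ^ 2 := by
    rw [hy, div_pow, hs2, mul_div_cancel₀ _ hq.ne', mul_pow]
  have e4 : 3 * (p * (1 - p) * y ^ 4) ≤ h ^ 4 := by
    have : p * (1 - p) * (3 * (p * (1 - p) * y ^ 4)) ≤ p * (1 - p) * h ^ 4 := by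
      calc p * (1 - p) * (3 * (p * (1 - p) * y ^ 4)) = 3 * (p * (1 - p) * y ^ 2) ^ 2 := by ring
        _ = 3 * ρ ^ 4 * h ^ 4 := by rw [e3]; ring
        _ ≤ _ := mul_le_mul_of_nonneg_right h4 (by positivity)
    exact le_of_mul_le_mul_left this hq
  have e5 : p * (1 - p) * y ^ 2 ≤ h ^ 2 / 4 := by
    rw [e3]; nlinarith [sq_nonneg h]
  have e6 : 8 * g ^ 2 * (p * (1 - p) * y ^ 2) ≤ 2 * g ^ 2 * h ^ 2 := by
    nlinarith [mul_le_mul_of_nonneg_left e5 (sq_nonneg g)]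
  have e7 : 4 * (1 - 2 * p) * g * y ^ 3 + (1 - 3 * (p * (1 - p))) * y ^ 4 ≤
      2 * g ^ 2 * y ^ 2 + 3 * y ^ 4 := by
    have : 0 ≤ y ^ 2 * (2 * (g - (1 - 2 * p) * y) ^ 2 +
        (2 + 3 * (p * (1 - p)) - 2 * (1 - 2 * p) ^ 2) * y ^ 2) := by
      have : 0 ≤ 2 + 3 * (p * (1 - p)) - 2 * (1 - 2 * p) ^ 2 := by nlinarith
      positivity
    nlinarith
  rw [e1, e2]
  have e8 := mul_le_mul_of_nonneg_left e7 hq.le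
  calc _ = g ^ 4 + 6 * g ^ 2 * (p * (1 - p) * y ^ 2) + p * (1 - p) *
        (4 * (1 - 2 * p) * g * y ^ 3 + (1 - 3 * (p * (1 - p))) * y ^ 4) := by ring
    _ ≤ g ^ 4 + 6 * g ^ 2 * (p * (1 - p) * y ^ 2) + p * (1 - p) *
        (2 * g ^ 2 * y ^ 2 + 3 * y ^ 4) := by linarith
    _ = g ^ 4 + 8 * g ^ 2 * (p * (1 - p) * y ^ 2) + 3 * (p * (1 - p) * y ^ 4) := by ring
    _ ≤ _ := by nlinarith

/-- Hypercontractivity from `L²` to `L⁴` on the biased cube. -/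
lemma expect_pow_four_le (hp : 0 < p) (hp1 : p < 1) {ρ : ℝ} (h2 : ρ ^ 2 ≤ 1 / 4)
    (h4 : 3 * ρ ^ 4 ≤ p * (1 - p)) (J : Finset (Fin N)) (c : Finset (Fin N) → ℝ) :
    bcubeE N p (fun x => (∑ S ∈ J.powerset, ρ ^ S.card * c S * walsh p S x) ^ 4) ≤
      (∑ S ∈ J.powerset, c S ^ 2) ^ 2 := by
  induction J using Finset.induction_on generalizing c with
  | empty => simp [walsh, expect_const]; exact le_of_eq (by ring)
  | insert i J hi ih =>
    set g : (Fin N → Bool) → ℝ := fun x => ∑ S ∈ J.powerset, ρ ^ S.card * c S * walsh p S x with hg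
    set h : (Fin N → Bool) → ℝ := fun x =>
      ∑ S ∈ J.powerset, ρ ^ S.card * c (insert i S) * walsh p S x with hh
    have hmem : ∀ S ∈ J.powerset, i ∉ S := fun S hS hiS => hi (Finset.mem_powerset.1 hS hiS)
    have hgu : ∀ x b, g (Function.update x i b) = g x := fun x b =>
      Finset.sum_congr rfl fun S hS => by rw [walsh_update_of_notMem (hmem S hS)]
    have hhu : ∀ x b, h (Function.update x i b) = h x := fun x b =>
      Finset.sum_congr rfl fun S hS => by rw [walsh_update_of_notMem (hmem S hS)]
    have hsplit : ∀ x, ∑ S ∈ (insert i J).powerset, ρ ^ S.card * c S * walsh p S x =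
        g x + ρ * coord p (x i) * h x := by
      intro x
      rw [Finset.sum_powerset_insert hi, hh, Finset.mul_sum]
      congr 1
      refine Finset.sum_congr rfl fun S hS => ?_
      rw [walsh_insert (hmem S hS), Finset.card_insert_of_notMem (hmem S hS)]
      ring
    have hG := ih c
    have hH := ih (fun S => c (insert i S))
    have hG0 : 0 ≤ ∑ S ∈ J.powerset, c S ^ 2 := Finset.sum_nonneg fun _ _ => sq_nonneg _
    have hH0 : 0 ≤ ∑ S ∈ J.powerset, c (insert i S) ^ 2 := Finset.sum_nonneg fun _ _ => sq_nonneg _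
    rw [Finset.sum_powerset_insert hi]
    set G := ∑ S ∈ J.powerset, c S ^ 2
    set H := ∑ S ∈ J.powerset, c (insert i S) ^ 2
    have hGH : bcubeE N p (fun x => g x ^ 2 * h x ^ 2) ≤ G * H := by
      refine le_of_abs_le (abs_le_of_sq_le_sq ?_ (mul_nonneg hG0 hH0))
      refine (expect_mul_sq_le hp hp1 _ _).trans ?_
      simp only [← pow_mul]
      rw [mul_pow]
      exact mul_le_mul hG hH (expect_nonneg hp hp1 fun x => Even.pow_nonneg ⟨2, rfl⟩ _) (sq_nonneg _)
    simp only [hsplit]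
    rw [← expect_avg i]
    calc _ ≤ bcubeE N p (fun x => g x ^ 4 + (2 * (g x ^ 2 * h x ^ 2) + h x ^ 4)) := by
          refine expect_mono hp hp1 fun x => ?_
          simp only [avg, hgu, hhu, Function.update_self]
          refine (two_point_le hp hp1 h2 h4 (g x) (h x)).trans (le_of_eq (by ring))
      _ = bcubeE N p (fun x => g x ^ 4) + (2 * bcubeE N p (fun x => g x ^ 2 * h x ^ 2) +
          bcubeE N p (fun x => h x ^ 4)) := by
          rw [expect_add, expect_add, expect_const_mul]
      _ ≤ G ^ 2 + (2 * (G * H) + H ^ 2) := by gcongr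
      _ = _ := by ring

/-- The dual smoothing estimate, interpolated between `L¹` and `L²`. -/
lemma sum_pow_mul_coeff_sq_le (hp : 0 < p) (hp1 : p < 1) {ρ : ℝ} (h2 : ρ ^ 2 ≤ 1 / 4)
    (h4 : 3 * ρ ^ 4 ≤ p * (1 - p)) (g : (Fin N → Bool) → ℝ) :
    ∑ S, (ρ ^ 2) ^ S.card * coeff p g S ^ 2 ≤
      bcubeE N p (fun x => |g x|) * √(bcubeE N p (fun x => g x ^ 2)) := by
  set A := ∑ S, (ρ ^ 2) ^ S.card * coeff p g S ^ 2 with hA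
  set h : (Fin N → Bool) → ℝ := fun x =>
    ∑ S, ρ ^ S.card * (ρ ^ S.card * coeff p g S) * walsh p S x with hh
  set b := bcubeE N p (fun x => |g x|) with hb
  set a := √(bcubeE N p (fun x => g x ^ 2)) with ha
  have hg0 : 0 ≤ bcubeE N p (fun x => g x ^ 2) := expect_nonneg hp hp1 fun _ => sq_nonneg _
  have ha2 : a ^ 2 = bcubeE N p (fun x => g x ^ 2) := Real.sq_sqrt hg0
  have ha0 : 0 ≤ a := Real.sqrt_nonneg _
  have hb0 : 0 ≤ b := expect_nonneg hp hp1 fun _ => abs_nonneg _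
  have hA0 : 0 ≤ A := Finset.sum_nonneg fun S _ => by positivity
  have hh4 : bcubeE N p (fun x => h x ^ 4) ≤ A ^ 2 := by
    have := expect_pow_four_le hp hp1 h2 h4 Finset.univ (fun S => ρ ^ S.card * coeff p g S)
    rw [Finset.powerset_univ] at this
    refine this.trans (le_of_eq ?_)
    congr 1
    exact Finset.sum_congr rfl fun S _ => by ring
  have hgh : bcubeE N p (fun x => g x * h x) = A := by
    simp only [hh, Finset.mul_sum]
    rw [expect_sum, hA]
    refine Finset.sum_congr rfl fun S _ => ?_
    have : (fun x => g x * (ρ ^ S.card * (ρ ^ S.card * coeff p g S) * walsh p S x)) =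
        fun x => ((ρ ^ 2) ^ S.card * coeff p g S) * (g x * walsh p S x) := by
      funext x; ring
    rw [this, expect_const_mul]
    change _ * coeff p g S = _
    ring
  have h5 : bcubeE N p (fun x => |g x| * h x ^ 2) ≤ a * A := by
    refine le_of_abs_le (abs_le_of_sq_le_sq ?_ (mul_nonneg ha0 hA0))
    refine (expect_mul_sq_le hp hp1 _ _).trans ?_
    simp only [sq_abs, ← pow_mul]
    rw [mul_pow, ha2]
    exact mul_le_mul_of_nonneg_left hh4 hg0
  have h6 : A ^ 2 ≤ b * bcubeE N p (fun x => |g x| * h x ^ 2) := by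
    rw [← hgh]
    refine Finset.sum_sq_le_sum_mul_sum_of_sq_le_mul _ (fun x _ => ?_) (fun x _ => ?_)
      fun x _ => le_of_eq ?_
    · exact mul_nonneg (weight_nonneg hp hp1 x) (abs_nonneg _)
    · exact mul_nonneg (weight_nonneg hp hp1 x) (by positivity)
    · rw [mul_pow, mul_pow, ← sq_abs (g x)]; ring
  have h7 : A * A ≤ b * a * A := by
    calc A * A = A ^ 2 := by ring
      _ ≤ b * (a * A) := h6.trans (mul_le_mul_of_nonneg_left h5 hb0)
      _ = _ := by ring
  rcases hA0.eq_or_lt with h0 | h0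
  · rw [← h0]; positivity
  · exact le_of_mul_le_mul_right h7 h0

/-- The centering of `f` in the `i`-th coordinate. -/
noncomputable def center (p : ℝ) (i : Fin N) (f : (Fin N → Bool) → ℝ) (x : Fin N → Bool) : ℝ :=
  f x - avg p i f x

lemma center_eq (i : Fin N) (f : (Fin N → Bool) → ℝ) (x : Fin N → Bool) :
    center p i f x = -(if x i then 1 - p else p) * bcubeD N i f x := by
  have hx : Function.update x i (x i) = x := Function.update_eq_self i x
  cases hb : x i <;> rw [hb] at hx <;> simp [center, avg, bcubeD, hb, hx] <;> ring

lemma abs_bcubeD_update (i : Fin N) (f : (Fin N → Bool) → ℝ) (x : Fin N → Bool) (b : Bool) :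
    |bcubeD N i f (Function.update x i b)| = |bcubeD N i f x| := by
  have hx : Function.update x i (x i) = x := Function.update_eq_self i x
  cases hb : x i <;> rw [hb] at hx <;> cases b <;> simp [bcubeD, hb, hx, abs_sub_comm]

lemma expect_center_sq (i : Fin N) (f : (Fin N → Bool) → ℝ) :
    bcubeE N p (fun x => center p i f x ^ 2) =
      p * (1 - p) * bcubeE N p (fun x => |bcubeD N i f x| ^ 2) := by
  rw [← expect_avg i, ← expect_const_mul]
  congr 1
  funext x
  simp only [avg, center_eq, mul_pow, neg_sq, ← sq_abs (bcubeD N i f _), abs_bcubeD_update,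
    Function.update_self]
  simp
  ring

lemma expect_abs_center (hp : 0 < p) (hp1 : p < 1) (i : Fin N) (f : (Fin N → Bool) → ℝ) :
    bcubeE N p (fun x => |center p i f x|) =
      2 * (p * (1 - p)) * bcubeE N p (fun x => |bcubeD N i f x|) := by
  have h3 : 0 < 1 - p := by linarith
  rw [← expect_avg i, ← expect_const_mul]
  congr 1
  funext x
  simp only [avg, center_eq, abs_mul, abs_neg, abs_bcubeD_update, Function.update_self]
  simp [abs_of_pos hp, abs_of_pos h3]
  ring

lemma avg_coord (i : Fin N) (x : Fin N → Bool) : avg p i (fun y => coord p (y i)) x = 0 := by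
  simp [avg, coord]
  ring

lemma coeff_center (i : Fin N) (f : (Fin N → Bool) → ℝ) (S : Finset (Fin N)) :
    coeff p (center p i f) S = if i ∈ S then coeff p f S else 0 := by
  have h : coeff p f S = coeff p (center p i f) S + coeff p (avg p i f) S := by
    simp only [coeff, ← expect_add, center]
    congr 1; funext x; ring
  split_ifs with hi
  · suffices coeff p (avg p i f) S = 0 by rw [h, this, add_zero]
    obtain ⟨T, hT, rfl⟩ : ∃ T, i ∉ T ∧ insert i T = S :=
      ⟨S.erase i, Finset.notMem_erase i S, Finset.insert_erase hi⟩
    rw [coeff, ← expect_avg i, ← expect_const (N := N) (p := p) 0]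
    congr 1
    funext x
    have h0 := avg_coord (p := p) i x
    simp only [avg, Function.update_self] at h0
    conv_lhs => rw [avg]
    simp only [avg_update, walsh_insert hT, walsh_update_of_notMem hT, Function.update_self]
    linear_combination (avg p i f x * walsh p T x) * h0
  · suffices coeff p (avg p i f) S = coeff p f S by linarith
    rw [coeff, coeff, ← expect_avg i (fun x => f x * walsh p S x)]
    congr 1
    funext x
    simp only [avg, walsh_update_of_notMem hi]
    ring

lemma variance_eq_sum (hp : 0 < p) (hp1 : p < 1) (f : (Fin N → Bool) → ℝ) :
    bcubeVar N p f = ∑ i, ∑ S, (S.card : ℝ)⁻¹ * coeff p (center p i f) S ^ 2 := by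
  rw [Finset.sum_comm, bcubeVar, ← sum_coeff_sq hp hp1,
    ← Finset.add_sum_erase _ _ (Finset.mem_univ ∅),
    ← Finset.add_sum_erase _ (fun S : Finset (Fin N) => ∑ i, _) (Finset.mem_univ ∅)]
  have h0 : coeff p f ∅ = bcubeE N p f := by simp [coeff, walsh]
  have h1 : ∀ S ∈ (Finset.univ : Finset (Finset (Fin N))).erase ∅,
      ∑ i, (S.card : ℝ)⁻¹ * coeff p (center p i f) S ^ 2 = coeff p f S ^ 2 := by
    intro S hS
    have hc : (S.card : ℝ) ≠ 0 := by
      simpa [Finset.card_eq_zero] using Finset.ne_of_mem_erase hS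
    simp only [coeff_center, ite_pow, mul_ite]
    simp [Finset.sum_ite_mem, hc]
  rw [Finset.sum_congr rfl h1, h0]
  simp

lemma inv_card_le {r m : ℝ} (hr : 0 < r) (hr1 : r ≤ 1) (hm : 0 < m) (s : ℕ) :
    (s : ℝ)⁻¹ ≤ m⁻¹ + r ^ (-m) * r ^ s := by
  have hrm : 0 ≤ r ^ (-m) * r ^ s := by positivity
  rcases le_total m s with h | h
  · have := inv_anti₀ hm h
    linarith
  · have h1 : 1 ≤ r ^ (-m) * r ^ s := by
      rw [← Real.rpow_natCast, ← Real.rpow_add hr]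
      exact Real.one_le_rpow_of_pos_of_le_one_of_nonpos hr hr1 (by linarith)
    have h2 : (s : ℝ)⁻¹ ≤ 1 := Nat.cast_inv_le_one s
    have h3 : 0 < m⁻¹ := inv_pos.2 hm
    linarith

lemma expect_abs_le_sqrt (hp : 0 < p) (hp1 : p < 1) (g : (Fin N → Bool) → ℝ) :
    bcubeE N p (fun x => |g x|) ≤ √(bcubeE N p (fun x => g x ^ 2)) := by
  refine Real.le_sqrt_of_sq_le ?_
  have h := expect_mul_sq_le hp hp1 (fun _ => 1) (fun x => |g x|)
  simpa [expect_one] using h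

lemma eq_zero_of_expect_abs_eq_zero (hp : 0 < p) (hp1 : p < 1) {g : (Fin N → Bool) → ℝ}
    (h : bcubeE N p (fun x => |g x|) = 0) : g = 0 := by
  funext x
  have hw : 0 < ∏ i : Fin N, if x i then p else 1 - p :=
    Finset.prod_pos fun i _ => by split_ifs <;> linarith
  have := (Finset.sum_eq_zero_iff_of_nonneg fun x _ =>
    mul_nonneg (weight_nonneg hp hp1 x) (abs_nonneg (g x))).1 h x (Finset.mem_univ x)
  simpa [hw.ne'] using this

lemma sum_inv_card_mul_coeff_sq_le (hp : 0 < p) (hp1 : p < 1) {ρ : ℝ} (h0 : 0 < ρ)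
    (h2 : ρ ^ 2 ≤ 1 / 4) (h4 : 3 * ρ ^ 4 ≤ p * (1 - p)) (g : (Fin N → Bool) → ℝ)
    (hg : 0 < bcubeE N p (fun x => |g x|)) :
    ∑ S, (S.card : ℝ)⁻¹ * coeff p g S ^ 2 ≤
      (2 * -Real.log (ρ ^ 2) + 4) * (bcubeE N p (fun x => g x ^ 2) /
        (1 + Real.log (√(bcubeE N p (fun x => g x ^ 2)) / bcubeE N p (fun x => |g x|)))) := by
  have hba := expect_abs_le_sqrt hp hp1 g
  have hsm := sum_pow_mul_coeff_sq_le hp hp1 h2 h4 g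
  have hpars := sum_coeff_sq hp hp1 g
  have hE : 0 ≤ bcubeE N p (fun x => g x ^ 2) := expect_nonneg hp hp1 fun _ => sq_nonneg _
  set b := bcubeE N p (fun x => |g x|)
  set E := bcubeE N p (fun x => g x ^ 2)
  set a := √E with ha
  have ha2 : a ^ 2 = E := Real.sq_sqrt hE
  have hapos : 0 < a := hg.trans_le hba
  set R := a / b with hR
  have hR1 : 1 ≤ R := (one_le_div hg).2 hba
  have hR0 : 0 < R := by linarith
  have hbR : b * a = E / R := by
    rw [hR, ← ha2]; field_simp
  set κ := -Real.log (ρ ^ 2) with hκ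
  have hρ2 : 0 < ρ ^ 2 := by positivity
  have hκ0 : 0 < κ := neg_pos.2 (Real.log_neg hρ2 (by linarith))
  set L := Real.log R with hL
  have hL0 : 0 ≤ L := Real.log_nonneg hR1
  set m := (1 + L) / (2 * κ) with hm
  have hm0 : 0 < m := by positivity
  have hpow : (ρ ^ 2) ^ (-m) = Real.exp (1 / 2 + L / 2) := by
    rw [Real.rpow_def_of_pos hρ2]
    congr 1
    rw [hm, show Real.log (ρ ^ 2) = -κ by rw [hκ]; ring]
    field_simp
  have hexp : Real.exp (1 / 2 + L / 2) / R ≤ 4 / (1 + L) := by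
    rw [div_le_div_iff₀ hR0 (by linarith)]
    have e1 : R = Real.exp (L / 2) * Real.exp (L / 2) := by
      rw [← Real.exp_add, add_halves, hL, Real.exp_log hR0]
    have e2 : Real.exp (1 / 2 : ℝ) ≤ 2 := by
      have e3 : Real.exp (1 / 2 : ℝ) ^ 2 = Real.exp 1 := by
        rw [sq, ← Real.exp_add]; norm_num
      have := Real.exp_one_lt_d9
      nlinarith [Real.exp_pos (1 / 2 : ℝ)]
    have e4 := Real.add_one_le_exp (L / 2)
    have e5 := Real.exp_pos (L / 2)
    rw [Real.exp_add, e1]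
    calc _ ≤ 2 * Real.exp (L / 2) * (2 * Real.exp (L / 2)) := by
          gcongr
          linarith
      _ = _ := by ring
  calc _ ≤ ∑ S, (m⁻¹ * coeff p g S ^ 2 +
        (ρ ^ 2) ^ (-m) * ((ρ ^ 2) ^ S.card * coeff p g S ^ 2)) := by
        refine Finset.sum_le_sum fun S _ => ?_
        have := mul_le_mul_of_nonneg_right (inv_card_le hρ2 (by linarith) hm0 S.card)
          (sq_nonneg (coeff p g S))
        linarith
    _ ≤ m⁻¹ * E + (ρ ^ 2) ^ (-m) * (b * a) := by
        rw [Finset.sum_add_distrib, ← Finset.mul_sum, ← Finset.mul_sum, hpars]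
        gcongr
    _ = 2 * κ / (1 + L) * E + Real.exp (1 / 2 + L / 2) / R * E := by
        rw [hpow, hbR, hm, inv_div]; ring
    _ ≤ 2 * κ / (1 + L) * E + 4 / (1 + L) * E := by gcongr
    _ = _ := by ring

lemma log_ratio_bounds_of_lt {q : ℝ} (hp : 0 < p) (hpq : p < q) (h1 : p + q = 1) :
    1 ≤ (Real.log q - Real.log p) / (q - p) ∧
      -Real.log (p * q) ≤ 3 * ((Real.log q - Real.log p) / (q - p)) := by
  have hq : 0 < q := hp.trans hpq
  have hd : 0 < q - p := by linarith
  have hlow : q - p ≤ Real.log q - Real.log p := by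
    rw [← Real.log_div hq.ne' hp.ne']
    refine le_trans ?_ (Real.one_sub_inv_le_log_of_pos (by positivity))
    rw [inv_div, one_sub_div hq.ne', le_div_iff₀ hq]
    nlinarith
  have hK1 : 1 ≤ (Real.log q - Real.log p) / (q - p) := (one_le_div hd).2 hlow
  have hK2 : Real.log q - Real.log p ≤ (Real.log q - Real.log p) / (q - p) := by
    rw [le_div_iff₀ hd]
    nlinarith
  have hlogq : -Real.log 2 ≤ Real.log q := by
    rw [← Real.log_inv]
    exact Real.log_le_log (by norm_num) (by linarith)
  have hlog2 := Real.log_two_lt_d9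
  refine ⟨hK1, ?_⟩
  rw [Real.log_mul hp.ne' hq.ne']
  linarith

lemma log_ratio_bounds (hp : 0 < p) (hp1 : p < 1) (hne : p ≠ 1 - p) :
    1 ≤ (Real.log p - Real.log (1 - p)) / (p - (1 - p)) ∧
      -Real.log (p * (1 - p)) ≤ 3 * ((Real.log p - Real.log (1 - p)) / (p - (1 - p))) := by
  rcases lt_or_gt_of_ne hne with h | h
  · rw [← neg_div_neg_eq, neg_sub, neg_sub]
    exact log_ratio_bounds_of_lt hp h (by ring)
  · rw [mul_comm]
    exact log_ratio_bounds_of_lt (by linarith) h (by ring)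

/-- A noise parameter that makes the `L²`–`L⁴` smoothing estimate available. -/
lemma exists_noise (hp : 0 < p) (hp1 : p < 1) (hne : p ≠ 1 - p) :
    ∃ ρ : ℝ, 0 < ρ ∧ ρ ^ 2 ≤ 1 / 4 ∧ 3 * ρ ^ 4 ≤ p * (1 - p) ∧
      2 * -Real.log (ρ ^ 2) + 4 ≤ 10 * ((Real.log p - Real.log (1 - p)) / (p - (1 - p))) := by
  obtain ⟨hK1, hK2⟩ := log_ratio_bounds hp hp1 hne
  have hs := sqrt_variance_pos hp hp1
  have hs2 := sq_sqrt_variance hp hp1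
  have hρ : √(√(p * (1 - p)) / 4) ^ 2 = √(p * (1 - p)) / 4 := Real.sq_sqrt (by positivity)
  have hlog2 := Real.log_two_lt_d9
  refine ⟨√(√(p * (1 - p)) / 4), by positivity, ?_, ?_, ?_⟩
  · rw [hρ]
    nlinarith
  · rw [show √(√(p * (1 - p)) / 4) ^ 4 = (√(√(p * (1 - p)) / 4) ^ 2) ^ 2 by ring, hρ, div_pow, hs2]
    nlinarith [mul_pos hp (sub_pos.2 hp1)]
  · rw [hρ, Real.log_div hs.ne' (by norm_num), Real.log_sqrt (mul_pos hp (sub_pos.2 hp1)).le,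
      show (4 : ℝ) = 2 ^ 2 by norm_num, Real.log_pow]
    push_cast
    linarith

lemma bcubeNorm_one (g : (Fin N → Bool) → ℝ) :
    bcubeNorm N p 1 g = bcubeE N p (fun x => |g x|) := by
  simp [bcubeNorm]

lemma bcubeNorm_two (g : (Fin N → Bool) → ℝ) :
    bcubeNorm N p 2 g = √(bcubeE N p (fun x => |g x| ^ 2)) := by
  simp only [bcubeNorm, Real.rpow_two, Real.sqrt_eq_rpow]

end BiasedCube

/-- Talagrand's inequality on the biased discrete cube. -/
theorem stmt3 :
    ∃ C : ℝ, 0 < C ∧ ∀ N : ℕ, 1 ≤ N → ∀ p : ℝ, 0 < p → p < 1 → p ≠ 1 - p →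
      ∀ f : (Fin N → Bool) → ℝ,
        bcubeVar N p f ≤
          C * p * (1 - p) * (Real.log p - Real.log (1 - p)) / (p - (1 - p)) *
            ∑ i : Fin N,
              if bcubeNorm N p 1 (bcubeD N i f) = 0 then 0 else
                bcubeNorm N p 2 (bcubeD N i f) ^ 2 /
                  (1 + Real.log (bcubeNorm N p 2 (bcubeD N i f) /
                    (2 * Real.sqrt (p * (1 - p)) * bcubeNorm N p 1 (bcubeD N i f)))) := by
  refine ⟨10, by norm_num, fun N _ p hp hp1 hne f => ?_⟩
  obtain ⟨ρ, h0, h2, h4, hκ⟩ := BiasedCube.exists_noise hp hp1 hne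
  have hq : 0 < p * (1 - p) := mul_pos hp (sub_pos.2 hp1)
  have hs := BiasedCube.sqrt_variance_pos hp hp1
  have hs2 := BiasedCube.sq_sqrt_variance hp hp1
  rw [BiasedCube.variance_eq_sum hp hp1, Finset.mul_sum]
  refine Finset.sum_le_sum fun i _ => ?_
  have hab := BiasedCube.expect_abs_center hp hp1 i f
  have hsq := BiasedCube.expect_center_sq (p := p) i f
  have hb0 : 0 ≤ bcubeE N p (fun x => |bcubeD N i f x|) :=
    BiasedCube.expect_nonneg hp hp1 fun _ => abs_nonneg _
  have ha0 : 0 ≤ bcubeE N p (fun x => |bcubeD N i f x| ^ 2) :=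
    BiasedCube.expect_nonneg hp hp1 fun _ => by positivity
  rw [BiasedCube.bcubeNorm_one, BiasedCube.bcubeNorm_two, Real.sq_sqrt ha0]
  split_ifs with hb
  · rw [hb, mul_zero] at hab
    simp [BiasedCube.eq_zero_of_expect_abs_eq_zero hp hp1 hab, BiasedCube.coeff,
      BiasedCube.expect_const]
  · have hbpos := hb0.lt_of_ne' hb
    have hcpos : 0 < bcubeE N p (fun x => |BiasedCube.center p i f x|) := by
      rw [hab]; positivity
    have hR := BiasedCube.expect_abs_le_sqrt hp hp1 (BiasedCube.center p i f)
    have hL := Real.log_nonneg ((one_le_div hcpos).2 hR)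
    have h := BiasedCube.sum_inv_card_mul_coeff_sq_le hp hp1 h0 h2 h4 _ hcpos
    rw [hsq, hab, Real.sqrt_mul hq.le] at h hL
    generalize bcubeE N p (fun x => |bcubeD N i f x|) = b at *
    generalize bcubeE N p (fun x => |bcubeD N i f x| ^ 2) = a at *
    have hratio : √(p * (1 - p)) * √a / (2 * (p * (1 - p)) * b) =
        √a / (2 * √(p * (1 - p)) * b) := by
      rw [← hs2, Real.sqrt_sq hs.le]
      field_simp
    rw [hratio] at h hL
    refine h.trans ((mul_le_mul_of_nonneg_right hκ (by positivity)).trans (le_of_eq ?_))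
    ring
end

section
/- Let G be a finite group with uniform probability measure μ, and let S ⊆ G be a symmetric generating set satisfying u S u^{−1} = S for all u ∈ S. Define D_s f(x) = f(sx) − f(x) for s ∈ S and the Dirichlet form 𝓔(f,f) = (1/(2|S|)) Σ_{s∈S} ‖D_s f‖₂². If ρ > 0 is such that ρ Ent_μ(f²) ≤ 2𝓔(f,f) for all f : G → ℝ, then for every f : G → ℝ, Var_μ(f) ≤ (2e/(ρ|S|)) · Σ_{s∈S} ‖D_s f‖₂² / (1 + log(‖D_s f‖₂ / ‖D_s f‖₁)), where summands with ‖D_s f‖₁ = 0 are interpreted as 0. -/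
/-- Expectation with respect to the uniform probability measure on a finite group. -/
noncomputable def grpE (G : Type*) [Fintype G] (g : G → ℝ) : ℝ :=
  (∑ x : G, g x) / Fintype.card G

/-- `L^p` norm with respect to the uniform probability measure. -/
noncomputable def grpNorm (G : Type*) [Fintype G] (p : ℝ) (g : G → ℝ) : ℝ :=
  (grpE G fun x => |g x| ^ p) ^ (1 / p)

/-- Variance with respect to the uniform probability measure. -/
noncomputable def grpVar (G : Type*) [Fintype G] (f : G → ℝ) : ℝ :=
  grpE G (fun x => f x ^ 2) - (grpE G f) ^ 2

/-- Entropy with respect to the uniform probability measure. -/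
noncomputable def grpEnt (G : Type*) [Fintype G] (g : G → ℝ) : ℝ :=
  grpE G (fun x => g x * Real.log (g x)) - grpE G g * Real.log (grpE G g)

/-- `D_s f (x) = f(sx) - f(x)`. -/
def grpD (G : Type*) [Group G] (s : G) (f : G → ℝ) (x : G) : ℝ :=
  f (s * x) - f x

section Expectation

variable {G : Type*} [Fintype G]

lemma grpE_add (g h : G → ℝ) : grpE G (fun x => g x + h x) = grpE G g + grpE G h := by
  simp only [grpE, Finset.sum_add_distrib, add_div]

lemma grpE_sub (g h : G → ℝ) : grpE G (fun x => g x - h x) = grpE G g - grpE G h := by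
  simp only [grpE, Finset.sum_sub_distrib, sub_div]

lemma grpE_const_mul (c : ℝ) (g : G → ℝ) : grpE G (fun x => c * g x) = c * grpE G g := by
  simp only [grpE, ← Finset.mul_sum, mul_div_assoc]

lemma grpE_div (c : ℝ) (g : G → ℝ) : grpE G (fun x => g x / c) = grpE G g / c := by
  simp only [grpE, ← Finset.sum_div]
  ring

lemma grpE_sum {ι : Type*} (S : Finset ι) (g : ι → G → ℝ) :
    grpE G (fun x => ∑ s ∈ S, g s x) = ∑ s ∈ S, grpE G (g s) := by
  simp only [grpE, Finset.sum_div]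
  exact Finset.sum_comm

lemma grpE_const [Nonempty G] (c : ℝ) : grpE G (fun _ => c) = c := by
  simp [grpE]

lemma grpE_mono {g h : G → ℝ} (H : ∀ x, g x ≤ h x) : grpE G g ≤ grpE G h := by
  unfold grpE
  gcongr
  exact H _

lemma grpE_nonneg {g : G → ℝ} (H : ∀ x, 0 ≤ g x) : 0 ≤ grpE G g :=
  div_nonneg (Finset.sum_nonneg fun x _ => H x) (Nat.cast_nonneg _)

lemma grpE_eq_zero_iff {g : G → ℝ} (H : ∀ x, 0 ≤ g x) : grpE G g = 0 ↔ ∀ x, g x = 0 := by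
  refine ⟨fun h x => ?_, fun h => by simp [grpE, h]⟩
  have : Nonempty G := ⟨x⟩
  have hc : (Fintype.card G : ℝ) ≠ 0 := Nat.cast_ne_zero.2 Fintype.card_ne_zero
  rw [grpE, div_eq_zero_iff, or_iff_left hc,
    Finset.sum_eq_zero_iff_of_nonneg fun x _ => H x] at h
  exact h x (Finset.mem_univ x)

lemma grpE_mul_left [Group G] (s : G) (g : G → ℝ) : grpE G (fun x => g (s * x)) = grpE G g := by
  unfold grpE
  congr 1
  exact Equiv.sum_comp (Equiv.mulLeft s) g

lemma grpNorm_one (g : G → ℝ) : grpNorm G 1 g = grpE G fun x => |g x| := by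
  simp [grpNorm]

lemma grpNorm_two_sq (g : G → ℝ) : grpNorm G 2 g ^ 2 = grpE G fun x => g x ^ 2 := by
  have h : 0 ≤ grpE G fun x => g x ^ 2 := grpE_nonneg fun x => sq_nonneg _
  simp only [grpNorm, Real.rpow_ofNat, sq_abs]
  rw [← Real.sqrt_eq_rpow, Real.sq_sqrt h]

lemma grpNorm_nonneg (p : ℝ) (g : G → ℝ) : 0 ≤ grpNorm G p g :=
  Real.rpow_nonneg (grpE_nonneg fun _ => Real.rpow_nonneg (abs_nonneg _) _) _

lemma grpVar_eq [Nonempty G] (f : G → ℝ) :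
    grpVar G f = grpE G fun x => (f x - grpE G f) ^ 2 := by
  have h : (fun x => (f x - grpE G f) ^ 2) =
      fun x => (f x ^ 2 - (2 * grpE G f) * f x) + grpE G f ^ 2 := by
    funext x; ring
  rw [h, grpE_add, grpE_sub, grpE_const_mul, grpE_const, grpVar]
  ring

lemma grpVar_nonneg [Nonempty G] (f : G → ℝ) : 0 ≤ grpVar G f := by
  rw [grpVar_eq]
  exact grpE_nonneg fun x => sq_nonneg _

lemma grpNorm_one_le_two [Nonempty G] (g : G → ℝ) : grpNorm G 1 g ≤ grpNorm G 2 g := by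
  refine (sq_le_sq₀ (grpNorm_nonneg 1 g) (grpNorm_nonneg 2 g)).1 ?_
  have h := grpVar_nonneg fun x => |g x|
  simp only [grpVar, sq_abs] at h
  rw [grpNorm_two_sq, grpNorm_one]
  linarith

/-- The entropy of `h²` controls the gap between the `L²` norm of `h` and any bound on its
`L¹` norm. -/
lemma mul_log_le_grpEnt_sq (h : G → ℝ) {a : ℝ} (ha : 0 < a)
    (hle : grpE G (fun x => |h x|) ≤ a) :
    grpE G (fun x => h x ^ 2) * Real.log (grpE G (fun x => h x ^ 2) / a ^ 2) ≤
      grpEnt G fun x => h x ^ 2 := by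
  set m := grpE G fun x => h x ^ 2 with hm
  have hm0 : 0 ≤ m := grpE_nonneg fun x => sq_nonneg _
  rcases hm0.eq_or_lt with h0 | hpos
  · have hz := (grpE_eq_zero_iff fun x => sq_nonneg (h x)).1 h0.symm
    simp only [grpEnt, hz, ← h0]
    simp [grpE]
  have hc : 0 < m / a := div_pos hpos ha
  have key : ∀ x, (2 * (Real.log (m / a) + 1)) * h x ^ 2 - (2 * (m / a)) * |h x| ≤
      h x ^ 2 * Real.log (h x ^ 2) := by
    intro x
    rw [← sq_abs (h x)]
    generalize hp : |h x| = p
    rcases (hp ▸ abs_nonneg (h x) : 0 ≤ p).eq_or_lt with rfl | hp0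
    · simp
    have hlog := Real.log_le_sub_one_of_pos (div_pos hc hp0)
    rw [Real.log_div hc.ne' hp0.ne'] at hlog
    have h1 := mul_le_mul_of_nonneg_left hlog (by positivity : 0 ≤ 2 * p ^ 2)
    have h2 : 2 * p ^ 2 * (m / a / p - 1) = 2 * (m / a) * p - 2 * p ^ 2 := by
      field_simp
    rw [Real.log_pow]
    push_cast
    nlinarith
  have hE := grpE_mono key
  rw [grpE_sub, grpE_const_mul, grpE_const_mul, ← hm] at hE
  have hca : 2 * (m / a) * grpE G (fun x => |h x|) ≤ 2 * m := by
    calc 2 * (m / a) * grpE G (fun x => |h x|) ≤ 2 * (m / a) * a := by gcongr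
      _ = 2 * m := by field_simp
  rw [Real.log_div hpos.ne' ha.ne'] at hE
  rw [grpEnt, ← hm, Real.log_div hpos.ne' (by positivity), Real.log_pow]
  push_cast
  nlinarith

end Expectation

section Walk

variable {G : Type*} [Group G] [Fintype G]

/-- Twice the Dirichlet form: the average over `s ∈ S` of `‖D_s f‖₂²`. -/
noncomputable def grpEnergy (S : Finset G) (f : G → ℝ) : ℝ :=
  (∑ s ∈ S, grpE G fun x => grpD G s f x ^ 2) / S.card

/-- One step of the random walk driven by `S` with jump probability `1 / 4`. -/
noncomputable def grpWalk (S : Finset G) (f : G → ℝ) (x : G) : ℝ :=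
  (∑ s ∈ S, (3 / 4 * f x + 1 / 4 * f (s * x))) / S.card

variable {S : Finset G}

lemma grpE_grpWalk (hS : S.Nonempty) (f : G → ℝ) : grpE G (grpWalk S f) = grpE G f := by
  have hc : (S.card : ℝ) ≠ 0 := Nat.cast_ne_zero.2 hS.card_pos.ne'
  have h (s : G) : grpE G (fun x => 3 / 4 * f x + 1 / 4 * f (s * x)) = grpE G f := by
    rw [grpE_add, grpE_const_mul, grpE_const_mul, grpE_mul_left]
    ring
  unfold grpWalk
  rw [grpE_div, grpE_sum]
  simp only [h, Finset.sum_const, nsmul_eq_mul]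
  field_simp

lemma grpE_abs_grpWalk_le (hS : S.Nonempty) (f : G → ℝ) :
    grpE G (fun x => |grpWalk S f x|) ≤ grpE G fun x => |f x| := by
  rw [← grpE_grpWalk hS fun x => |f x|]
  refine grpE_mono fun x => ?_
  unfold grpWalk
  rw [abs_div, Nat.abs_cast]
  gcongr
  refine (Finset.abs_sum_le_sum_abs _ _).trans (Finset.sum_le_sum fun s _ => ?_)
  refine (abs_add_le _ _).trans_eq ?_
  rw [abs_mul, abs_mul, abs_of_pos (by norm_num : (0 : ℝ) < 3 / 4),
    abs_of_pos (by norm_num : (0 : ℝ) < 1 / 4)]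

lemma grpE_sq_grpWalk_le (hS : S.Nonempty) (f : G → ℝ) :
    grpE G (fun x => grpWalk S f x ^ 2) ≤
      grpE G (fun x => f x ^ 2) - 3 / 16 * grpEnergy S f := by
  have hc : (0 : ℝ) < S.card := Nat.cast_pos.2 hS.card_pos
  have h1 : ∀ x, grpWalk S f x ^ 2 ≤
      (∑ s ∈ S, (3 / 4 * f x ^ 2 + 1 / 4 * f (s * x) ^ 2 - 3 / 16 * grpD G s f x ^ 2)) /
        S.card := by
    intro x
    have h := sq_sum_le_card_mul_sum_sq (s := S) (f := fun s => 3 / 4 * f x + 1 / 4 * f (s * x))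
    unfold grpWalk
    rw [div_pow, div_le_div_iff₀ (by positivity) hc]
    have e : ∑ s ∈ S, (3 / 4 * f x ^ 2 + 1 / 4 * f (s * x) ^ 2 - 3 / 16 * grpD G s f x ^ 2) =
        ∑ s ∈ S, (3 / 4 * f x + 1 / 4 * f (s * x)) ^ 2 :=
      Finset.sum_congr rfl fun s _ => by unfold grpD; ring
    rw [e]
    nlinarith
  have h2 (s : G) : grpE G (fun x => 3 / 4 * f x ^ 2 + 1 / 4 * f (s * x) ^ 2 -
      3 / 16 * grpD G s f x ^ 2) =
      grpE G (fun x => f x ^ 2) - 3 / 16 * grpE G (fun x => grpD G s f x ^ 2) := by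
    rw [grpE_sub, grpE_add, grpE_const_mul, grpE_const_mul, grpE_const_mul,
      grpE_mul_left s fun x => f x ^ 2]
    ring
  refine (grpE_mono h1).trans_eq ?_
  rw [grpE_div, grpE_sum]
  simp only [h2, Finset.sum_sub_distrib, Finset.sum_const, nsmul_eq_mul, ← Finset.mul_sum]
  unfold grpEnergy
  field_simp

lemma grpE_sq_sub_le (hS : S.Nonempty) (f : G → ℝ) :
    grpE G (fun x => f x ^ 2) - 1 / 4 * grpEnergy S f ≤
      grpE G (fun x => grpWalk S f x ^ 2) := by
  have hc : (0 : ℝ) < S.card := Nat.cast_pos.2 hS.card_pos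
  have h1 : ∀ x, (∑ s ∈ S, (3 / 4 * f x ^ 2 + 1 / 4 * f (s * x) ^ 2 -
      1 / 4 * grpD G s f x ^ 2)) / S.card ≤ grpWalk S f x ^ 2 := by
    intro x
    have e : ∑ s ∈ S, (3 / 4 * f x ^ 2 + 1 / 4 * f (s * x) ^ 2 - 1 / 4 * grpD G s f x ^ 2) =
        2 * f x * ∑ s ∈ S, (3 / 4 * f x + 1 / 4 * f (s * x)) - S.card * f x ^ 2 := by
      rw [Finset.mul_sum, ← nsmul_eq_mul, ← Finset.sum_const, ← Finset.sum_sub_distrib]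
      exact Finset.sum_congr rfl fun s _ => by unfold grpD; ring
    rw [e, sub_div, mul_div_cancel_left₀ _ hc.ne', mul_div_assoc]
    change 2 * f x * grpWalk S f x - f x ^ 2 ≤ _
    nlinarith [sq_nonneg (f x - grpWalk S f x)]
  have h2 (s : G) : grpE G (fun x => 3 / 4 * f x ^ 2 + 1 / 4 * f (s * x) ^ 2 -
      1 / 4 * grpD G s f x ^ 2) =
      grpE G (fun x => f x ^ 2) - 1 / 4 * grpE G (fun x => grpD G s f x ^ 2) := by
    rw [grpE_sub, grpE_add, grpE_const_mul, grpE_const_mul, grpE_const_mul,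
      grpE_mul_left s fun x => f x ^ 2]
    ring
  refine Eq.trans_le ?_ (grpE_mono h1)
  rw [grpE_div, grpE_sum]
  simp only [h2, Finset.sum_sub_distrib, Finset.sum_const, nsmul_eq_mul, ← Finset.mul_sum]
  unfold grpEnergy
  field_simp

lemma grpE_grpD (s : G) (f : G → ℝ) : grpE G (grpD G s f) = 0 := by
  unfold grpD
  rw [grpE_sub, grpE_mul_left, sub_self]

lemma grpE_grpWalk_iterate (hS : S.Nonempty) (f : G → ℝ) (k : ℕ) :
    grpE G ((grpWalk S)^[k] f) = grpE G f := by
  induction k with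
  | zero => rfl
  | succ k ih => rw [Function.iterate_succ_apply', grpE_grpWalk hS, ih]

lemma grpE_abs_grpWalk_iterate_le (hS : S.Nonempty) (f : G → ℝ) (k : ℕ) :
    grpE G (fun x => |(grpWalk S)^[k] f x|) ≤ grpE G fun x => |f x| := by
  induction k with
  | zero => exact le_rfl
  | succ k ih =>
    rw [Function.iterate_succ_apply']
    exact (grpE_abs_grpWalk_le hS _).trans ih

/-- The log-Sobolev inequality implies a spectral gap inequality. -/
lemma mul_grpVar_le_grpEnergy {ρ : ℝ} (hρ : 0 ≤ ρ)
    (hLSI : ∀ f : G → ℝ, ρ * grpEnt G (fun x => f x ^ 2) ≤ grpEnergy S f) (f : G → ℝ) :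
    ρ * grpVar G f ≤ grpEnergy S f := by
  obtain ⟨M, hM⟩ : ∃ M : ℝ, ∀ x, |f x - grpE G f| ≤ M := by
    obtain ⟨M, hM⟩ := (Set.finite_range fun x => |f x - grpE G f|).bddAbove
    exact ⟨M, fun x => hM ⟨x, rfl⟩⟩
  have hM0 : 0 ≤ M := (abs_nonneg _).trans (hM 1)
  set F : G → ℝ := fun x => (f x - grpE G f) + (M + 1) with hF
  have hE1 : grpE G (fun x => |F x|) = M + 1 := by
    have h : (fun x => |F x|) = F := by
      funext x
      exact abs_of_nonneg (by have := (abs_le.1 (hM x)).1; simp only [hF]; linarith)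
    rw [h, hF, grpE_add, grpE_sub, grpE_const, grpE_const]
    ring
  have hE2 : grpE G (fun x => F x ^ 2) = (M + 1) ^ 2 + grpVar G f := by
    have h : (fun x => F x ^ 2) = fun x => (f x - grpE G f) ^ 2 +
        (2 * (M + 1) * (f x - grpE G f) + (M + 1) ^ 2) := by
      funext x; simp only [hF]; ring
    rw [h, grpE_add, grpE_add, grpE_const_mul, grpE_sub, grpE_const, grpE_const, ← grpVar_eq]
    ring
  have hA : grpEnergy S F = grpEnergy S f := by
    simp [grpEnergy, grpD, hF]
  have hv := grpVar_nonneg f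
  have hent := mul_log_le_grpEnt_sq F (by linarith : 0 < M + 1) hE1.le
  rw [hE2] at hent
  have hq : 0 < (M + 1) ^ 2 := by positivity
  have hlog := Real.one_sub_inv_le_log_of_pos
    (by positivity : 0 < ((M + 1) ^ 2 + grpVar G f) / (M + 1) ^ 2)
  have hmul := mul_le_mul_of_nonneg_left hlog (by positivity : 0 ≤ (M + 1) ^ 2 + grpVar G f)
  have hs : ((M + 1) ^ 2 + grpVar G f) * (1 - (((M + 1) ^ 2 + grpVar G f) / (M + 1) ^ 2)⁻¹) =
      grpVar G f := by
    have : (M + 1) ^ 2 + grpVar G f ≠ 0 := by positivity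
    field_simp
    ring
  calc ρ * grpVar G f ≤ ρ * grpEnt G (fun x => F x ^ 2) := by gcongr; linarith
    _ ≤ grpEnergy S F := hLSI F
    _ = grpEnergy S f := hA

lemma grpVar_grpWalk_iterate_tendsto {c : ℝ} (hc : 0 < c) (hS : S.Nonempty)
    (hgap : ∀ f : G → ℝ, c * grpVar G f ≤ grpEnergy S f) (f : G → ℝ) :
    Filter.Tendsto (fun N => grpVar G ((grpWalk S)^[N] f)) Filter.atTop (nhds 0) := by
  have hstep (k : ℕ) : 3 / 16 * c * grpVar G ((grpWalk S)^[k] f) ≤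
      grpVar G ((grpWalk S)^[k] f) - grpVar G ((grpWalk S)^[k + 1] f) := by
    have h := grpE_sq_grpWalk_le hS ((grpWalk S)^[k] f)
    have h' := hgap ((grpWalk S)^[k] f)
    rw [Function.iterate_succ_apply']
    simp only [grpVar, grpE_grpWalk hS] at h' ⊢
    linarith
  have hsum : Summable fun k => 3 / 16 * c * grpVar G ((grpWalk S)^[k] f) := by
    refine summable_of_sum_range_le (c := grpVar G f)
      (fun k => mul_nonneg (by positivity) (grpVar_nonneg _)) fun N => ?_
    refine (Finset.sum_le_sum fun k _ => hstep k).trans ?_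
    rw [Finset.sum_range_sub' fun k => grpVar G ((grpWalk S)^[k] f)]
    simpa using grpVar_nonneg ((grpWalk S)^[N] f)
  have h := hsum.tendsto_atTop_zero.const_mul (3 / 16 * c)⁻¹
  have hc' : 3 / 16 * c ≠ 0 := by positivity
  simpa only [inv_mul_cancel_left₀ hc', mul_zero] using h

lemma grpVar_sub_grpVar_iterate_le (hS : S.Nonempty) (f : G → ℝ) (N : ℕ) :
    grpVar G f - grpVar G ((grpWalk S)^[N] f) ≤
      ∑ k ∈ Finset.range N, 1 / 4 * grpEnergy S ((grpWalk S)^[k] f) := by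
  have h := Finset.sum_range_sub' (fun k => grpVar G ((grpWalk S)^[k] f)) N
  simp only [Function.iterate_zero, id] at h
  rw [← h]
  refine Finset.sum_le_sum fun k _ => ?_
  have h := grpE_sq_sub_le hS ((grpWalk S)^[k] f)
  rw [Function.iterate_succ_apply']
  simp only [grpVar, grpE_grpWalk hS]
  linarith

end Walk

/-- `D_s` commutes with the walk when conjugation by `s` preserves `S`. -/
lemma grpD_grpWalk {G : Type*} [Group G] {S : Finset G} {s : G}
    (hs : ∀ u ∈ S, s * u * s⁻¹ ∈ S) (hs' : ∀ u ∈ S, s⁻¹ * u * s ∈ S) (f : G → ℝ) :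
    grpD G s (grpWalk S f) = grpWalk S (grpD G s f) := by
  have hre (x : G) : ∑ u ∈ S, f (u * (s * x)) = ∑ u ∈ S, f (s * (u * x)) :=
    Finset.sum_nbij' (fun u => s⁻¹ * u * s) (fun u => s * u * s⁻¹) hs' hs
      (fun u _ => by group) (fun u _ => by group) fun u _ => by group
  funext x
  simp only [grpD, grpWalk, Finset.sum_add_distrib, ← Finset.mul_sum, mul_sub,
    Finset.sum_sub_distrib, Finset.sum_const, nsmul_eq_mul]
  rw [hre]
  ring

lemma grpD_grpWalk_iterate {G : Type*} [Group G] {S : Finset G} {s : G}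
    (hs : ∀ u ∈ S, s * u * s⁻¹ ∈ S)
    (hs' : ∀ u ∈ S, s⁻¹ * u * s ∈ S) (f : G → ℝ) (k : ℕ) :
    grpD G s ((grpWalk S)^[k] f) = (grpWalk S)^[k] (grpD G s f) := by
  induction k with
  | zero => rfl
  | succ k ih =>
    rw [Function.iterate_succ_apply', grpD_grpWalk hs hs', ih, Function.iterate_succ_apply']

/-- A sequence decaying at rate `c` throughout, and at rate `c * log (φ k / n)` while that is
larger, has total mass `O(φ 0 / log (φ 0 / n))`. -/
lemma mul_sum_range_le_of_log_decay {φ : ℕ → ℝ} {c n : ℝ} (hc : 0 < c) (hn : 0 < n)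
    (hφ : ∀ k, 0 ≤ φ k) (h1 : ∀ k, c * φ k ≤ φ k - φ (k + 1))
    (h2 : ∀ k, c * (φ k * Real.log (φ k / n)) ≤ φ k - φ (k + 1)) (h0 : n ≤ φ 0) (N : ℕ) :
    c * ∑ k ∈ Finset.range N, φ k ≤ 3 * (φ 0 / (1 + Real.log (φ 0 / n) / 2)) := by
  have hφ0 : 0 < φ 0 := hn.trans_le h0
  set l := Real.log (φ 0 / n) / 2 with hl
  have hl0 : 0 ≤ l := div_nonneg (Real.log_nonneg ((one_le_div hn).2 h0)) two_pos.le
  set τ := φ 0 * Real.exp (-l) with hτ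
  have hτ0 : 0 < τ := by positivity
  have hanti (k : ℕ) : φ (k + 1) ≤ φ k := by
    have := h1 k
    have := mul_nonneg hc.le (hφ k)
    linarith
  have hlogτ : Real.log (τ / n) = l := by
    have h : Real.log (φ 0 / n) = 2 * l := by rw [hl]; ring
    rw [hτ, mul_div_right_comm, Real.log_mul (by positivity) (Real.exp_pos _).ne', h,
      Real.log_exp]
    ring
  have hstep (k : ℕ) : c * φ k ≤
      (2 / (1 + l) * φ k + min (φ k) τ) - (2 / (1 + l) * φ (k + 1) + min (φ (k + 1)) τ) := by
    have hd : 0 ≤ φ k - φ (k + 1) := sub_nonneg.2 (hanti k)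
    rcases le_total (φ k) τ with h | h
    · rw [min_eq_left h, min_eq_left ((hanti k).trans h)]
      have : 0 ≤ 2 / (1 + l) * (φ k - φ (k + 1)) := by positivity
      linarith [h1 k]
    · have hmin : min (φ (k + 1)) τ ≤ min (φ k) τ := min_le_min_right _ (hanti k)
      have hlog : l ≤ Real.log (φ k / n) := by
        rw [← hlogτ]
        exact Real.log_le_log (by positivity) (by gcongr)
      have h3 : c * (φ k * l) ≤ φ k - φ (k + 1) := by
        refine le_trans ?_ (h2 k)
        have := hφ k
        gcongr
      have h4 : c * φ k ≤ 2 / (1 + l) * (φ k - φ (k + 1)) := by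
        rw [div_mul_eq_mul_div, le_div_iff₀ (by positivity)]
        linarith [h1 k]
      linarith
  have hsum := Finset.sum_le_sum fun k (_ : k ∈ Finset.range N) => hstep k
  rw [Finset.sum_range_sub' fun k => 2 / (1 + l) * φ k + min (φ k) τ, ← Finset.mul_sum] at hsum
  have hend : 0 ≤ 2 / (1 + l) * φ N + min (φ N) τ := by
    have := hφ N
    positivity
  have hτle : τ ≤ φ 0 / (1 + l) := by
    rw [hτ, Real.exp_neg, ← div_eq_mul_inv]
    gcongr
    linarith [Real.add_one_le_exp l]
  have hmin : min (φ 0) τ ≤ φ 0 / (1 + l) := (min_le_right _ _).trans hτle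
  have e : 2 / (1 + l) * φ 0 = 2 * (φ 0 / (1 + l)) := by ring
  linarith

/-- Along the walk, the accumulated `L²` mass of a mean zero function is smaller by a logarithmic
factor than the spectral gap alone predicts. -/
lemma sum_range_grpE_sq_iterate_le {G : Type*} [Group G] [Fintype G] {S : Finset G} {ρ : ℝ}
    (hρ : 0 < ρ) (hS : S.Nonempty)
    (hLSI : ∀ f : G → ℝ, ρ * grpEnt G (fun x => f x ^ 2) ≤ grpEnergy S f)
    (g : G → ℝ) (hg : grpE G g = 0) (N : ℕ) :
    ρ * ∑ k ∈ Finset.range N, grpE G (fun x => (grpWalk S)^[k] g x ^ 2) ≤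
      16 * if grpNorm G 1 g = 0 then 0 else
        grpNorm G 2 g ^ 2 / (1 + Real.log (grpNorm G 2 g / grpNorm G 1 g)) := by
  set φ : ℕ → ℝ := fun k => grpE G fun x => (grpWalk S)^[k] g x ^ 2 with hφdef
  have habs (k : ℕ) := grpE_abs_grpWalk_iterate_le hS g k
  rw [← grpNorm_one] at habs
  split_ifs with h0
  · have hz (k : ℕ) : φ k = 0 := by
      have h := ((habs k).trans_eq h0).antisymm (grpE_nonneg fun x => abs_nonneg _)
      rw [grpE_eq_zero_iff fun x => abs_nonneg _] at h
      exact (grpE_eq_zero_iff fun x => sq_nonneg _).2 fun x => by rw [abs_eq_zero.1 (h x)]; simp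
    simp [hz]
  have ha : 0 < grpNorm G 1 g := (grpNorm_nonneg 1 g).lt_of_ne' h0
  have hb : 0 < grpNorm G 2 g := ha.trans_le (grpNorm_one_le_two g)
  have hdecay (k : ℕ) : 3 / 16 * grpEnergy S ((grpWalk S)^[k] g) ≤ φ k - φ (k + 1) := by
    have h := grpE_sq_grpWalk_le hS ((grpWalk S)^[k] g)
    simp only [hφdef, Function.iterate_succ_apply']
    linarith
  have hφ0 : φ 0 = grpNorm G 2 g ^ 2 := (grpNorm_two_sq g).symm
  have h := mul_sum_range_le_of_log_decay (φ := φ) (c := 3 / 16 * ρ) (n := grpNorm G 1 g ^ 2)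
    (by positivity) (by positivity) (fun k => grpE_nonneg fun x => sq_nonneg _)
    (fun k => by
      have h := mul_grpVar_le_grpEnergy hρ.le hLSI ((grpWalk S)^[k] g)
      rw [grpVar, grpE_grpWalk_iterate hS, hg] at h
      have h' := hdecay k
      have e : φ k = grpE G fun x => (grpWalk S)^[k] g x ^ 2 := rfl
      rw [← e] at h
      linarith)
    (fun k => by
      have h := mul_le_mul_of_nonneg_left (mul_log_le_grpEnt_sq _ ha (habs k)) hρ.le
      have h' := hLSI ((grpWalk S)^[k] g)
      have e : φ k = grpE G fun x => (grpWalk S)^[k] g x ^ 2 := rfl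
      rw [← e] at h
      linarith [hdecay k])
    (by rw [hφ0]; have := grpNorm_one_le_two g; gcongr) N
  have hlog : Real.log (grpNorm G 2 g ^ 2 / grpNorm G 1 g ^ 2) / 2 =
      Real.log (grpNorm G 2 g / grpNorm G 1 g) := by
    rw [← div_pow, Real.log_pow]
    push_cast
    ring
  rw [hφ0, hlog] at h
  linarith

/-- Talagrand's inequality on a finite group with a conjugacy-stable symmetric
set of generators (O'Donnell-Wimmer). -/
theorem stmt6 (G : Type*) [Group G] [Fintype G] [DecidableEq G] (S : Finset G)
    (hsym : ∀ s ∈ S, s⁻¹ ∈ S)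
    (hgen : Subgroup.closure (S : Set G) = ⊤)
    (hconj : ∀ u ∈ S, ∀ s ∈ S, u * s * u⁻¹ ∈ S)
    (ρ : ℝ) (hρ : 0 < ρ)
    (hLSI : ∀ f : G → ℝ,
      ρ * grpEnt G (fun x => f x ^ 2) ≤
        2 * ((1 / (2 * (S.card : ℝ))) * ∑ s ∈ S, grpNorm G 2 (grpD G s f) ^ 2))
    (f : G → ℝ) :
    grpVar G f ≤ (2 * Real.exp 1 / (ρ * S.card)) * ∑ s ∈ S,
      if grpNorm G 1 (grpD G s f) = 0 then 0 else
        grpNorm G 2 (grpD G s f) ^ 2 /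
          (1 + Real.log (grpNorm G 2 (grpD G s f) / grpNorm G 1 (grpD G s f))) := by
  have hLSI' : ∀ f : G → ℝ, ρ * grpEnt G (fun x => f x ^ 2) ≤ grpEnergy S f := by
    intro f
    refine (hLSI f).trans_eq ?_
    simp only [grpNorm_two_sq, grpEnergy]
    ring
  have hgap := mul_grpVar_le_grpEnergy hρ.le hLSI'
  rcases S.eq_empty_or_nonempty with rfl | hS
  · have h := hgap f
    simp only [grpEnergy, Finset.sum_empty, zero_div] at h
    simpa using nonpos_of_mul_nonpos_right h hρ
  have hc : (0 : ℝ) < S.card := Nat.cast_pos.2 hS.card_pos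
  set T : G → ℝ := fun s => if grpNorm G 1 (grpD G s f) = 0 then 0 else
    grpNorm G 2 (grpD G s f) ^ 2 /
      (1 + Real.log (grpNorm G 2 (grpD G s f) / grpNorm G 1 (grpD G s f)))
  have hbound (N : ℕ) : grpVar G f - grpVar G ((grpWalk S)^[N] f) ≤
      4 / (ρ * S.card) * ∑ s ∈ S, T s := by
    have hD : ∀ s ∈ S, ∀ k, grpD G s ((grpWalk S)^[k] f) = (grpWalk S)^[k] (grpD G s f) :=
      fun s hs => grpD_grpWalk_iterate (hconj s hs)
        (fun u hu => by simpa using hconj s⁻¹ (hsym s hs) u hu) f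
    have hsum : ∑ s ∈ S, ρ * ∑ k ∈ Finset.range N,
        grpE G (fun x => grpD G s ((grpWalk S)^[k] f) x ^ 2) ≤ ∑ s ∈ S, 16 * T s := by
      refine Finset.sum_le_sum fun s hs => ?_
      simp only [hD s hs]
      exact sum_range_grpE_sq_iterate_le hρ hS hLSI' _ (grpE_grpD s f) N
    rw [← Finset.mul_sum, ← Finset.mul_sum, Finset.sum_comm] at hsum
    refine (grpVar_sub_grpVar_iterate_le hS f N).trans ?_
    simp only [grpEnergy]
    rw [← Finset.mul_sum, ← Finset.sum_div, div_mul_eq_mul_div 4,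
      le_div_iff₀ (by positivity)]
    field_simp
    linarith
  have hlim := (grpVar_grpWalk_iterate_tendsto hρ hS hgap f).const_sub (grpVar G f)
  rw [sub_zero] at hlim
  refine (le_of_tendsto' hlim hbound).trans ?_
  have hT0 : 0 ≤ ∑ s ∈ S, T s := Finset.sum_nonneg fun s _ => by
    have h := sum_range_grpE_sq_iterate_le hρ hS hLSI' _ (grpE_grpD s f) 0
    simp only [Finset.range_zero, Finset.sum_empty, mul_zero] at h
    change 0 ≤ 16 * T s at h
    linarith
  gcongr
  linarith [Real.add_one_le_exp 1]
end
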